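/- Let K be a field, d ∈ K, and n ≥ 1, and suppose the quantum integers satisfy [k] ≠ 0 in K for all 1 ≤ k ≤ n. Then the Temperley–Lieb algebra T_n over (K,d) contains a unique Jones–Wenzl idempotent p_n, and its Markov trace is Tr_n(p_n) = [n+1]. -/

import Mathlib

/-!
Common definitions: the Temperley–Lieb category over a field `K` with loop
parameter `d`.

An `(m,n)`-Temperley–Lieb diagram is a noncrossing perfect matching of `m`
marked points on the top edge and `n` marked points on the bottom edge of a
rectangle.  We encode it as a fixed-point-free involution of
`Fin m ⊕ Fin n` (`Sum.inl i` is the `i`-th top point, `Sum.inr j` the `j`-th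
bottom point) which is noncrossing with respect to the boundary order of the
points (top points from left to right, then bottom points from right to left).
-/

open scoped Classical

namespace TL

/-- The position of a marked point in the linear boundary order of the
rectangle: top points `0, …, m-1` from left to right, then bottom points
from right to left. -/
def bIdx (m n : ℕ) : Fin m ⊕ Fin n → ℕ
  | Sum.inl i => (i : ℕ)
  | Sum.inr j => m + (n - 1 - (j : ℕ))

/-- An `(m,n)`-Temperley–Lieb diagram: a noncrossing perfect matching
(= fixed-point-free involution) of the `m` top points and `n` bottom points. -/
structure Diagram (m n : ℕ) where
  pair : Fin m ⊕ Fin n → Fin m ⊕ Fin n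
  involutive : Function.Involutive pair
  fixedPointFree : ∀ x, pair x ≠ x
  noncrossing : ∀ x y, ¬ (bIdx m n x < bIdx m n y ∧ bIdx m n y < bIdx m n (pair x) ∧
      bIdx m n (pair x) < bIdx m n (pair y))

noncomputable instance (m n : ℕ) : Fintype (Diagram m n) :=
  Fintype.ofInjective (fun D => D.pair)
    (fun a b h => by cases a; cases b; simpa using h)

/-- `Hom K m n` is the `K`-vector space of morphisms from `m` to `n`:
the free vector space on the set of `(m,n)`-TL diagrams, realized as the
space of `K`-valued functions on the (finite) set of diagrams. -/
abbrev Hom (K : Type) [Field K] (m n : ℕ) : Type := Diagram m n → K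

variable {K : Type} [Field K]

/-- The basis vector of `Hom K m n` corresponding to a single diagram. -/
noncomputable def single {m n : ℕ} (p : Diagram m n) : Hom K m n :=
  fun c => if c = p then 1 else 0

/-! ### Composition -/

/-- The marked points of the picture obtained by stacking an `(l,m)`-diagram
on top of an `(m,n)`-diagram: `l` top points, `m` middle points, `n` bottom
points. -/
abbrev Pt (l m n : ℕ) := Fin l ⊕ (Fin m ⊕ Fin n)

/-- One strand of the stacked picture: either a strand of the top diagram `a`
(on the `l` top and `m` middle points) or a strand of the bottom diagram `b`
(on the `m` middle and `n` bottom points). -/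
def Step {l m n : ℕ} (a : Diagram l m) (b : Diagram m n) : Pt l m n → Pt l m n → Prop :=
  fun x y =>
    (∃ u : Fin l ⊕ Fin m, Sum.map id Sum.inl u = x ∧ Sum.map id Sum.inl (a.pair u) = y) ∨
    (∃ u : Fin m ⊕ Fin n, Sum.inr u = x ∧ Sum.inr (b.pair u) = y)

/-- Connectivity in the stacked picture: two marked points are connected if
they are joined by a path of strands. -/
def Conn {l m n : ℕ} (a : Diagram l m) (b : Diagram m n) : Pt l m n → Pt l m n → Prop :=
  Relation.EqvGen (Step a b)

/-- The points of the middle layer whose connected component stays entirely in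
the middle layer; these components are exactly the closed loops produced when
stacking. -/
def ClosedMid {l m n : ℕ} (a : Diagram l m) (b : Diagram m n) : Set (Pt l m n) :=
  {x | (∃ j : Fin m, x = Sum.inr (Sum.inl j)) ∧
    ∀ y, Conn a b x y → ∃ j : Fin m, y = Sum.inr (Sum.inl j)}

/-- The number of closed loops produced when stacking `a` on top of `b`:
the number of connected components consisting entirely of middle points. -/
noncomputable def numLoops {l m n : ℕ} (a : Diagram l m) (b : Diagram m n) : ℕ :=
  Nat.card (Quotient (⟨fun x y : ClosedMid a b => Conn a b x.1 y.1,
    ⟨fun _ => Relation.EqvGen.refl _, fun h => Relation.EqvGen.symm _ _ h,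
      fun h h' => Relation.EqvGen.trans _ _ _ h h'⟩⟩ : Setoid (ClosedMid a b)))

/-- Composition of two diagrams `b ∘ a` (stack `a` on top of `b`, delete the
`r` closed loops, multiply by `d ^ r`), expressed as an element of
`Hom K l n`: the result is `d ^ r` times the unique `(l,n)`-diagram inducing
the same pairing of the outer points as the connectivity of the stacked
picture. -/
noncomputable def compD (d : K) {l m n : ℕ} (b : Diagram m n) (a : Diagram l m) :
    Hom K l n :=
  fun c =>
    if ∀ x : Fin l ⊕ Fin n,
        Conn a b (Sum.map id Sum.inr x) (Sum.map id Sum.inr (c.pair x))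
    then d ^ numLoops a b else 0

/-- Composition `b ∘ a : Hom K l n` of `b : Hom K m n` with `a : Hom K l m`
(bilinear extension of composition of diagrams). -/
noncomputable def comp (d : K) {l m n : ℕ} (b : Hom K m n) (a : Hom K l m) :
    Hom K l n :=
  fun c => ∑ p : Diagram m n, ∑ q : Diagram l m, b p * a q * compD d p q c

/-! ### Tensor product -/

/-- Relabelling of the marked points of a horizontal juxtaposition of an
`(m,n)`-diagram (placed on the left) and an `(m',n')`-diagram (on the right). -/
def tEquiv (m n m' n' : ℕ) :
    (Fin (m + m') ⊕ Fin (n + n')) ≃ ((Fin m ⊕ Fin n) ⊕ (Fin m' ⊕ Fin n')) :=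
  (Equiv.sumCongr finSumFinEquiv.symm finSumFinEquiv.symm).trans
    (Equiv.sumSumSumComm _ _ _ _)

/-- The pairing of the horizontal juxtaposition of two diagrams. -/
def tensorPair {m n m' n' : ℕ} (a : Diagram m n) (b : Diagram m' n') :
    Fin (m + m') ⊕ Fin (n + n') → Fin (m + m') ⊕ Fin (n + n') :=
  fun x => (tEquiv m n m' n').symm (Sum.map a.pair b.pair (tEquiv m n m' n' x))

/-- The tensor product (horizontal juxtaposition) of two diagrams, as an
element of `Hom K (m+m') (n+n')`: the basis vector of the unique diagram whose
pairing is the juxtaposed pairing. -/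
noncomputable def tensorD {m n m' n' : ℕ} (a : Diagram m n) (b : Diagram m' n') :
    Hom K (m + m') (n + n') :=
  fun c => if c.pair = tensorPair a b then 1 else 0

/-- The tensor product of morphisms (bilinear extension of horizontal
juxtaposition of diagrams). -/
noncomputable def tensor {m n m' n' : ℕ} (x : Hom K m n) (y : Hom K m' n') :
    Hom K (m + m') (n + n') :=
  fun c => ∑ p : Diagram m n, ∑ q : Diagram m' n', x p * y q * tensorD p q c

/-! ### Identity, cup and cap -/

/-- The identity diagram `1_n`: `n` vertical strands. -/
def idD (n : ℕ) : Diagram n n where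
  pair := Sum.elim Sum.inr Sum.inl
  involutive := by rintro (i | i) <;> rfl
  fixedPointFree := by rintro (i | i) <;> simp
  noncrossing := by
    rintro (i | i) (j | j) <;>
      · simp only [Sum.elim_inl, Sum.elim_inr, bIdx]
        have hi := i.isLt; have hj := j.isLt; omega

/-- The identity morphism `1_n ∈ T_n`. -/
noncomputable def idHom (K : Type) [Field K] (n : ℕ) : Hom K n n :=
  fun c => if c = idD n then 1 else 0

/-- The cap `∩`: the unique `(0,2)`-TL diagram. -/
def capD : Diagram 0 2 where
  pair := fun x => match x with
    | Sum.inl i => i.elim0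
    | Sum.inr j => Sum.inr ⟨1 - (j : ℕ), by omega⟩
  involutive := by intro x; revert x; decide
  fixedPointFree := by decide
  noncrossing := by decide

/-- The cup `∪`: the unique `(2,0)`-TL diagram. -/
def cupD : Diagram 2 0 where
  pair := fun x => match x with
    | Sum.inl j => Sum.inl ⟨1 - (j : ℕ), by omega⟩
    | Sum.inr i => i.elim0
  involutive := by intro x; revert x; decide
  fixedPointFree := by decide
  noncrossing := by decide

/-- The cap `∩` as a morphism in `Hom K 0 2`. -/
noncomputable def capHom (K : Type) [Field K] : Hom K 0 2 :=
  fun c => if c = capD then 1 else 0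

/-- The cup `∪` as a morphism in `Hom K 2 0`. -/
noncomputable def cupHom (K : Type) [Field K] : Hom K 2 0 :=
  fun c => if c = cupD then 1 else 0

/-! ### The Markov trace -/

/-- The strands of the picture obtained from an `(n,n)`-diagram `p` by closing
it up: joining, for each `i`, the `i`-th top point to the `i`-th bottom point
(by nested arcs passing to the right of the rectangle). -/
def closeStep {n : ℕ} (p : Diagram n n) : (Fin n ⊕ Fin n) → (Fin n ⊕ Fin n) → Prop :=
  fun x y => p.pair x = y ∨ Sum.elim Sum.inr Sum.inl x = y

/-- The number `c(p)` of closed loops of the closure of an `(n,n)`-diagram. -/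
noncomputable def trLoops {n : ℕ} (p : Diagram n n) : ℕ :=
  Nat.card (Quotient (Relation.EqvGen.setoid (closeStep p)))

/-- The Markov trace `Tr_n : T_n → K`, sending a diagram `p` to
`d ^ c(p)`. -/
noncomputable def Tr (d : K) {n : ℕ} (x : Hom K n n) : K :=
  ∑ p : Diagram n n, x p * d ^ trLoops p

/-! ### Conditional expectations -/

/-- The conditional expectation `ε_n : T_{n+1} → T_n`,
`a ↦ (1_n ⊗ ∪) ∘ (a ⊗ 1_1) ∘ (1_n ⊗ ∩)` (closing up the last strand). -/
noncomputable def eps (d : K) (n : ℕ) (a : Hom K (n + 1) (n + 1)) : Hom K n n :=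
  let u : Hom K n (n + 2) := tensor (idHom K n) (capHom K)
  let v : Hom K (n + 2) (n + 2) := @tensor K _ (n + 1) (n + 1) 1 1 a (idHom K 1)
  let w : Hom K (n + 2) n := tensor (idHom K n) (cupHom K)
  comp d w (comp d v u)

/-- The iterated conditional expectation `ε_{n,n+m} = ε_n ∘ ε_{n+1} ∘ ⋯ ∘ ε_{n+m-1} :
T_{n+m} → T_n`. -/
noncomputable def epsIter (d : K) (n : ℕ) : (m : ℕ) → Hom K (n + m) (n + m) → Hom K n n
  | 0, a => a
  | m + 1, a => epsIter d n m (eps d (n + m) a)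

/-! ### Tensor powers of cup and cap -/

/-- `∩^{⊗k} ∈ Hom(0, 2k)`. -/
noncomputable def capPow (K : Type) [Field K] : (k : ℕ) → Hom K 0 (2 * k)
  | 0 => idHom K 0
  | k + 1 => tensor (capPow K k) (capHom K)

/-- `∪^{⊗k} ∈ Hom(2k, 0)`. -/
noncomputable def cupPow (K : Type) [Field K] : (k : ℕ) → Hom K (2 * k) 0
  | 0 => idHom K 0
  | k + 1 => tensor (cupPow K k) (cupHom K)

/-! ### Ideals -/

/-- An ideal of the Temperley–Lieb category over `(K, d)`: a family of vector
subspaces `J m n ⊆ Hom K m n` closed under composition with arbitrary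
morphisms on either side and under tensor product with arbitrary morphisms on
either side. -/
structure IsIdeal (d : K) (J : ∀ m n : ℕ, Set (Hom K m n)) : Prop where
  zero_mem : ∀ m n : ℕ, (0 : Hom K m n) ∈ J m n
  add_mem : ∀ (m n : ℕ), ∀ x ∈ J m n, ∀ y ∈ J m n, x + y ∈ J m n
  smul_mem : ∀ (m n : ℕ) (c : K), ∀ x ∈ J m n, c • x ∈ J m n
  comp_mem_left : ∀ {l m n : ℕ} (b : Hom K m n) (a : Hom K l m),
    a ∈ J l m → comp d b a ∈ J l n
  comp_mem_right : ∀ {l m n : ℕ} (b : Hom K m n) (a : Hom K l m),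
    b ∈ J m n → comp d b a ∈ J l n
  tensor_mem_left : ∀ {m n m' n' : ℕ} (x : Hom K m n) (y : Hom K m' n'),
    x ∈ J m n → tensor x y ∈ J (m + m') (n + n')
  tensor_mem_right : ∀ {m n m' n' : ℕ} (x : Hom K m n) (y : Hom K m' n'),
    y ∈ J m' n' → tensor x y ∈ J (m + m') (n + n')

/-- An ideal is nonzero if some `J m n` contains a nonzero morphism. -/
def IdealNonzero (J : ∀ m n : ℕ, Set (Hom K m n)) : Prop :=
  ∃ (m n : ℕ) (x : Hom K m n), x ∈ J m n ∧ x ≠ 0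

/-- An ideal is proper if it does not contain all morphisms. -/
def IdealProper (J : ∀ m n : ℕ, Set (Hom K m n)) : Prop :=
  ∃ m n : ℕ, J m n ≠ Set.univ

/-- The negligible morphisms: `a ∈ Hom(m,n)` with `Tr_m (b ∘ a) = 0` for all
`b ∈ Hom(n,m)`. -/
def Negl (d : K) (m n : ℕ) : Set (Hom K m n) :=
  {a | ∀ b : Hom K n m, Tr d (comp d b a) = 0}

/-- The ideal generated by a morphism `x ∈ Hom K a b`: the smallest ideal
containing `x`, i.e. the intersection of all ideals containing `x`. -/
def genIdeal (d : K) {a b : ℕ} (x : Hom K a b) (m n : ℕ) : Set (Hom K m n) :=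
  {y | ∀ J : ∀ m' n' : ℕ, Set (Hom K m' n'), IsIdeal d J → x ∈ J a b → y ∈ J m n}

/-! ### Jones–Wenzl idempotents -/

/-- The diagram `E_i ∈ T_n` (here `i` is 0-indexed, `i + 1 < n`): it joins the
`i`-th and `(i+1)`-st top points, the `i`-th and `(i+1)`-st bottom points, and
joins the `j`-th top point vertically to the `j`-th bottom point for all other
`j`; encoded as a pairing function. -/
def eiPair (n i : ℕ) : Fin n ⊕ Fin n → Fin n ⊕ Fin n
  | Sum.inl j =>
      if (j : ℕ) = i then
        Sum.inl ⟨((j : ℕ) + 1) % n, Nat.mod_lt _ (Nat.lt_of_le_of_lt (Nat.zero_le _) j.isLt)⟩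
      else if (j : ℕ) = i + 1 then
        Sum.inl ⟨(j : ℕ) - 1, Nat.lt_of_le_of_lt (Nat.sub_le _ _) j.isLt⟩
      else Sum.inr j
  | Sum.inr j =>
      if (j : ℕ) = i then
        Sum.inr ⟨((j : ℕ) + 1) % n, Nat.mod_lt _ (Nat.lt_of_le_of_lt (Nat.zero_le _) j.isLt)⟩
      else if (j : ℕ) = i + 1 then
        Sum.inr ⟨(j : ℕ) - 1, Nat.lt_of_le_of_lt (Nat.sub_le _ _) j.isLt⟩
      else Sum.inl j

/-- The morphism `E_i ∈ T_n` (0-indexed `i`). -/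
noncomputable def EHom (K : Type) [Field K] (n i : ℕ) : Hom K n n :=
  fun c => if c.pair = eiPair n i then 1 else 0

/-- A Jones–Wenzl idempotent in `T_n`: a nonzero idempotent `p` with
`E_i ∘ p = p ∘ E_i = 0` for all `i` (1-indexed `1 ≤ i ≤ n-1`; here `i` is
0-indexed, so `i + 2 ≤ n`). -/
def IsJonesWenzl (d : K) (n : ℕ) (p : Hom K n n) : Prop :=
  p ≠ 0 ∧ comp d p p = p ∧
    ∀ i : ℕ, i + 2 ≤ n → comp d (EHom K n i) p = 0 ∧ comp d p (EHom K n i) = 0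

/-- The quantum integers `[k] ∈ K`: `[0] = 0`, `[1] = 1`,
`[k+1] = d·[k] − [k−1]`. -/
def qInt (d : K) : ℕ → K
  | 0 => 0
  | 1 => 1
  | k + 2 => d * qInt d (k + 1) - qInt d k

/-! ### Two-colourings and connectivity -/

theorem eqvGen_iff_forall_bool {α : Type*} (r : α → α → Prop) (x y : α) :
    Relation.EqvGen r x y ↔ ∀ f : α → Bool, (∀ u v, r u v → f u = f v) → f x = f y := by
  constructor
  · intro h f hf
    induction h with
    | rel _ _ h => exact hf _ _ h
    | refl _ => rfl
    | symm _ _ _ ih => exact ih.symm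
    | trans _ _ _ _ _ ih₁ ih₂ => exact ih₁.trans ih₂
  · intro h
    have h1 := h (fun z => decide (Relation.EqvGen r x z)) fun u v huv => by
      simp only [decide_eq_decide]
      exact ⟨fun hu => hu.trans _ _ _ (.rel _ _ huv),
        fun hv => hv.trans _ _ _ (.symm _ _ (.rel _ _ huv))⟩
    simpa [Relation.EqvGen.refl] using h1

section Dihedral

variable {α : Type*} {A B : Equiv.Perm α} {x : α}

theorem snd_zpow_apply (hA : A * A = 1) (hB : B * B = 1) (hx : B x = x) (k : ℤ) :
    B (((A * B) ^ k) x) = ((A * B) ^ (-k)) x := by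
  have h : B * (A * B) * B⁻¹ = (A * B)⁻¹ := by
    rw [mul_inv_rev, ← mul_assoc, mul_assoc, mul_inv_cancel, mul_one, inv_eq_of_mul_eq_one_left hA,
      inv_eq_of_mul_eq_one_left hB]
  have h1 : B * (A * B) ^ k = (A * B) ^ (-k) * B := by
    rw [zpow_neg, ← inv_zpow, ← h, conj_zpow, inv_mul_cancel_right]
  rw [← Equiv.Perm.mul_apply, h1, Equiv.Perm.mul_apply, hx]

theorem fst_zpow_apply (hA : A * A = 1) (hB : B * B = 1) (hx : B x = x) (k : ℤ) :
    A (((A * B) ^ k) x) = ((A * B) ^ (1 - k)) x := by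
  have h : A = (A * B) * B := by rw [mul_assoc, hB, mul_one]
  conv_lhs => rw [h]
  rw [Equiv.Perm.mul_apply, ← h, snd_zpow_apply hA hB hx, sub_eq_add_neg, zpow_add, zpow_one]
  rfl

/-- If `x` is fixed by one of two involutions `A`, `B`, then the orbit of `x` under the group they
generate contains at most one other point fixed by `A` or by `B`. -/
theorem eq_of_fixed_of_mem_orbit (hA : A * A = 1) (hB : B * B = 1)
    {y z : α} (hx : B x = x) (hy : ∃ k : ℤ, y = ((A * B) ^ k) x)
    (hz : ∃ k : ℤ, z = ((A * B) ^ k) x) (hyx : y ≠ x) (hzx : z ≠ x)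
    (hy' : A y = y ∨ B y = y) (hz' : A z = z ∨ B z = z) : y = z := by
  have hBk := snd_zpow_apply hA hB hx
  have hAk := fst_zpow_apply hA hB hx
  set T := A * B with hT
  have hper : ∀ k : ℤ, (T ^ k) x = x ↔
      (Function.minimalPeriod (T • ·) x : ℤ) ∣ k := fun k =>
    MulAction.zpow_smul_eq_iff_minimalPeriod_dvd (a := T) (b := x) (n := k)
  have heq : ∀ j k : ℤ, (T ^ j) x = (T ^ k) x ↔
      (Function.minimalPeriod (T • ·) x : ℤ) ∣ j - k := by
    intro j k
    rw [← hper, sub_eq_neg_add, zpow_add, Equiv.Perm.mul_apply, zpow_neg, Equiv.Perm.inv_eq_iff_eq,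
      eq_comm]
  obtain ⟨j, rfl⟩ := hy
  obtain ⟨k, rfl⟩ := hz
  rw [ne_eq, hper] at hyx hzx
  rw [hAk, hBk, heq, heq] at hy' hz'
  rw [heq]
  generalize (Function.minimalPeriod (T • ·) x : ℤ) = r at *
  have half : ∀ i c : ℤ, 2 * i = r * c → (¬ r ∣ i) → c % 2 = 1 := by
    intro i c h h'
    by_contra hc
    obtain ⟨b, rfl⟩ : (2 : ℤ) ∣ c := by omega
    exact h' ⟨b, by linarith⟩
  have odd : ∀ i c : ℤ, 2 * i - 1 = r * c → r % 2 = 1 ∧ c % 2 = 1 := by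
    intro i c h
    have h1 : (r * c) % 2 = 1 := by omega
    rw [Int.mul_emod] at h1
    rcases Int.emod_two_eq_zero_or_one r with hr | hr <;>
      rcases Int.emod_two_eq_zero_or_one c with hc | hc <;> simp_all
  have conc : ∀ a b : ℤ, 2 * (j - k) = r * (a - b) → a % 2 = 1 → b % 2 = 1 → r ∣ j - k := by
    intro a b h ha hb
    obtain ⟨c, hc⟩ : (2 : ℤ) ∣ a - b := by omega
    rw [hc] at h
    exact ⟨c, by linarith⟩
  rcases hy' with ⟨a, ha⟩ | ⟨a, ha⟩ <;> rcases hz' with ⟨b, hb⟩ | ⟨b, hb⟩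
  · have h1 := odd j (-a) (by linarith)
    have h2 := odd k (-b) (by linarith)
    exact conc (-a) (-b) (by linarith) h1.2 h2.2
  · have h1 := odd j (-a) (by linarith)
    have h2 := half k (-b) (by linarith) hzx
    have h3 : (r * (-b)) % 2 = 0 := by rw [show r * (-b) = 2 * k by linarith]; omega
    rw [Int.mul_emod, h1.1, h2] at h3
    simp at h3
  · have h1 := odd k (-b) (by linarith)
    have h2 := half j (-a) (by linarith) hyx
    have h3 : (r * (-a)) % 2 = 0 := by rw [show r * (-a) = 2 * j by linarith]; omega
    rw [Int.mul_emod, h1.1, h2] at h3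
    simp at h3
  · exact conc (-a) (-b) (by linarith) (half j (-a) (by linarith) hyx) (half k (-b) (by linarith) hzx)

end Dihedral

theorem Diagram.ext_pair {m n : ℕ} {a b : Diagram m n} (h : a.pair = b.pair) : a = b := by
  cases a; cases b; simpa using h

/-- The `0`-`1` matrix whose `(f, g)`-entry tells whether colouring the top points by `f` and the
bottom points by `g` gives both ends of every strand of `a` the same colour. -/
def colMat {m n : ℕ} (a : Diagram m n) : Matrix (Fin m → Bool) (Fin n → Bool) ℕ :=
  fun f g => if ∀ x, Sum.elim f g (a.pair x) = Sum.elim f g x then 1 else 0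

section Stack

variable {l m n : ℕ} (a : Diagram l m) (b : Diagram m n)

/-- The strands of `a`, as an involution of the points of the stacked picture. -/
def stackTop : Equiv.Perm (Pt l m n) :=
  Function.Involutive.toPerm
    (Sum.elim (fun i => Sum.map id Sum.inl (a.pair (Sum.inl i)))
      (Sum.elim (fun j => Sum.map id Sum.inl (a.pair (Sum.inr j))) (fun k => Sum.inr (Sum.inr k))))
    (by
      have key : ∀ w : Fin l ⊕ Fin m, Sum.elim (fun i => Sum.map id Sum.inl (a.pair (Sum.inl i)))
          (Sum.elim (fun j => Sum.map id Sum.inl (a.pair (Sum.inr j)))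
            (fun k : Fin n => (Sum.inr (Sum.inr k) : Pt l m n)))
          (Sum.map id Sum.inl w) = Sum.map id Sum.inl (a.pair w) := by
        rintro (i | j) <;> rfl
      rintro (i | j | k)
      · simp [key, a.involutive (Sum.inl i)]
      · simp [key, a.involutive (Sum.inr j)]
      · rfl)

/-- The strands of `b`, as an involution of the points of the stacked picture. -/
def stackBot : Equiv.Perm (Pt l m n) :=
  Function.Involutive.toPerm (Sum.map id b.pair) (by
    rintro (i | w)
    · rfl
    · simp [b.involutive w])

theorem stackTop_mul_self : stackTop (n := n) a * stackTop a = 1 := by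
  exact Equiv.ext fun x => Function.Involutive.toPerm_involutive _ x

theorem stackBot_mul_self : stackBot (l := l) b * stackBot b = 1 := by
  exact Equiv.ext fun x => Function.Involutive.toPerm_involutive _ x

theorem stackTop_map (w : Fin l ⊕ Fin m) :
    stackTop (n := n) a (Sum.map id Sum.inl w) = Sum.map id Sum.inl (a.pair w) := by
  rcases w with i | j <;> rfl

theorem Conn.mem_iff {a : Diagram l m} {b : Diagram m n} {x y : Pt l m n} (h : Conn a b x y)
    (Q : Pt l m n → Prop) (hA : ∀ x, Q x → Q (stackTop a x)) (hB : ∀ x, Q x → Q (stackBot b x)) :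
    Q x ↔ Q y := by
  have hA' : ∀ x, Q x ↔ Q (stackTop a x) := fun x => ⟨hA x, fun h => by
    have := hA _ h
    rwa [← Equiv.Perm.mul_apply, stackTop_mul_self] at this⟩
  have hB' : ∀ x, Q x ↔ Q (stackBot b x) := fun x => ⟨hB x, fun h => by
    have := hB _ h
    rwa [← Equiv.Perm.mul_apply, stackBot_mul_self] at this⟩
  have h1 := (eqvGen_iff_forall_bool _ _ _).1 h (fun z => decide (Q z)) (by
    rintro u v (⟨w, rfl, rfl⟩ | ⟨w, rfl, rfl⟩)
    · rw [decide_eq_decide, ← stackTop_map]; exact hA' _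
    · rw [decide_eq_decide]; exact hB' (Sum.inr w))
  simpa using h1

/-- A component of the stacked picture has at most two outer points. -/
theorem Conn.eq_of_outer {a : Diagram l m} {b : Diagram m n} {x y z : Fin l ⊕ Fin n}
    (hy : Conn a b (Sum.map id Sum.inr x) (Sum.map id Sum.inr y))
    (hz : Conn a b (Sum.map id Sum.inr x) (Sum.map id Sum.inr z)) (hyx : y ≠ x) (hzx : z ≠ x) :
    y = z := by
  have inj : Function.Injective (Sum.map id Sum.inr : Fin l ⊕ Fin n → Pt l m n) :=
    Function.Injective.sumMap Function.injective_id Sum.inr_injective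
  have fixed : ∀ w : Fin l ⊕ Fin n, stackTop a (Sum.map id Sum.inr w) = Sum.map id Sum.inr w ∨
      stackBot b (Sum.map id Sum.inr w) = Sum.map id Sum.inr w := by
    rintro (i | k)
    · exact Or.inr rfl
    · exact Or.inl rfl
  refine inj ?_
  have hyx' := inj.ne hyx
  have hzx' := inj.ne hzx
  have hA := stackTop_mul_self (n := n) a
  have hB := stackBot_mul_self (l := l) b
  rcases fixed x with h | h
  · have mem : ∀ {q}, Conn a b (Sum.map id Sum.inr x) q →
        ∃ k : ℤ, q =
          ((stackBot b * stackTop a) ^ k : Equiv.Perm _) (Sum.map id Sum.inr x) := fun hq =>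
      (hq.mem_iff (fun q => ∃ k : ℤ, q =
          ((stackBot b * stackTop a) ^ k : Equiv.Perm _) (Sum.map id Sum.inr x))
        (fun q ⟨k, hk⟩ => ⟨_, hk ▸ snd_zpow_apply hB hA h k⟩)
        (fun q ⟨k, hk⟩ => ⟨_, hk ▸ fst_zpow_apply hB hA h k⟩)).1 ⟨0, rfl⟩
    exact eq_of_fixed_of_mem_orbit hB hA h (mem hy) (mem hz) hyx' hzx' (fixed y).symm (fixed z).symm
  · have mem : ∀ {q}, Conn a b (Sum.map id Sum.inr x) q →
        ∃ k : ℤ, q =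
          ((stackTop a * stackBot b) ^ k : Equiv.Perm _) (Sum.map id Sum.inr x) := fun hq =>
      (hq.mem_iff (fun q => ∃ k : ℤ, q =
          ((stackTop a * stackBot b) ^ k : Equiv.Perm _) (Sum.map id Sum.inr x))
        (fun q ⟨k, hk⟩ => ⟨_, hk ▸ fst_zpow_apply hA hB h k⟩)
        (fun q ⟨k, hk⟩ => ⟨_, hk ▸ snd_zpow_apply hA hB h k⟩)).1 ⟨0, rfl⟩
    exact eq_of_fixed_of_mem_orbit hA hB h (mem hy) (mem hz) hyx' hzx' (fixed y) (fixed z)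

end Stack

section Stack

variable {l m n : ℕ}

theorem colMat_mul_colMat (a : Diagram l m) (b : Diagram m n) (f : Fin l → Bool) (g : Fin m → Bool)
    (h : Fin n → Bool) : colMat a f g * colMat b g h =
      if ∀ u v, Step a b u v → Sum.elim f (Sum.elim g h) u = Sum.elim f (Sum.elim g h) v
      then 1 else 0 := by
  have key : (∀ u v, Step a b u v → Sum.elim f (Sum.elim g h) u = Sum.elim f (Sum.elim g h) v) ↔
      (∀ x, Sum.elim f g (a.pair x) = Sum.elim f g x) ∧
      ∀ x, Sum.elim g h (b.pair x) = Sum.elim g h x := by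
    have e1 : ∀ w : Fin l ⊕ Fin m, Sum.elim f (Sum.elim g h) (Sum.map id Sum.inl w) =
        Sum.elim f g w := by rintro (i | j) <;> rfl
    constructor
    · intro H
      refine ⟨fun x => ?_, fun x => ?_⟩
      · have := H _ _ (Or.inl ⟨x, rfl, rfl⟩)
        rw [e1, e1] at this
        exact this.symm
      · exact (H _ _ (Or.inr ⟨x, rfl, rfl⟩)).symm
    · rintro ⟨h1, h2⟩ u v (⟨w, rfl, rfl⟩ | ⟨w, rfl, rfl⟩)
      · rw [e1, e1, h1]
      · exact (h2 w).symm
  simp only [colMat, key]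
  split_ifs <;> simp_all

theorem colMat_apply_const (a : Diagram m n) (t : Bool) : colMat a (fun _ => t) (fun _ => t) = 1 := by
  have : ∀ w : Fin m ⊕ Fin n, Sum.elim (fun _ => t) (fun _ => t) w = t := by
    rintro (i | j) <;> rfl
  simp [colMat, this]

/-- `c` is the diagram obtained by stacking `a` on top of `b` and deleting the closed loops. -/
def IsStack (a : Diagram l m) (b : Diagram m n) (c : Diagram l n) : Prop :=
  ∀ x, Conn a b (Sum.map id Sum.inr x) (Sum.map id Sum.inr (c.pair x))

theorem compD_apply (d : K) (a : Diagram l m) (b : Diagram m n) (c : Diagram l n) :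
    compD d b a c = if IsStack a b c then d ^ numLoops a b else 0 := by
  unfold compD IsStack
  congr

theorem mid_closed_or_conn (a : Diagram l m) (b : Diagram m n) (j : Fin m) :
    Sum.inr (Sum.inl j) ∈ ClosedMid a b ∨
      ∃ y : Fin l ⊕ Fin n, Conn a b (Sum.inr (Sum.inl j)) (Sum.map id Sum.inr y) := by
  by_contra! H
  refine H.1 ⟨⟨j, rfl⟩, ?_⟩
  rintro (i | i | i) hy
  · exact (H.2 (Sum.inl i) hy).elim
  · exact ⟨i, rfl⟩
  · exact (H.2 (Sum.inr i) hy).elim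

theorem ClosedMid.of_conn {a : Diagram l m} {b : Diagram m n} {x y : Pt l m n}
    (hx : x ∈ ClosedMid a b) (h : Conn a b x y) : y ∈ ClosedMid a b :=
  ⟨hx.2 y h, fun z hz => hx.2 z (h.trans _ _ _ hz)⟩

theorem outer_notMem_closedMid (a : Diagram l m) (b : Diagram m n) (y : Fin l ⊕ Fin n) :
    Sum.map id Sum.inr y ∉ ClosedMid a b := by
  rintro ⟨⟨j, hj⟩, -⟩
  rcases y with y | y <;> simp at hj

/-- A compatible colouring of the outer points extends to `2 ^ r` colourings of the stacked picture,
where `r` is the number of closed loops. -/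
theorem IsStack.colMat_mul {a : Diagram l m} {b : Diagram m n} {c : Diagram l n}
    (hc : IsStack a b c) : colMat a * colMat b = 2 ^ numLoops a b • colMat c := by
  ext f h
  simp only [Matrix.mul_apply, colMat_mul_colMat, Matrix.smul_apply, smul_eq_mul]
  have elim_map : ∀ (g : Fin m → Bool) (w : Fin l ⊕ Fin n),
      Sum.elim f (Sum.elim g h) (Sum.map id Sum.inr w) = Sum.elim f h w := by
    rintro g (i | j) <;> rfl
  by_cases hfh : ∀ x, Sum.elim f h (c.pair x) = Sum.elim f h x
  swap
  · rw [colMat, if_neg hfh, mul_zero]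
    refine Finset.sum_eq_zero fun g _ => if_neg fun H => hfh fun x => ?_
    have := (eqvGen_iff_forall_bool _ _ _).1 (hc x) _ H
    rw [elim_map, elim_map] at this
    exact this.symm
  rw [colMat, if_pos hfh, mul_one, Finset.sum_boole, Nat.cast_id, ← Fintype.card_subtype]
  set S : Setoid (ClosedMid a b) := ⟨fun x y : ClosedMid a b => Conn a b x.1 y.1,
    ⟨fun _ => Relation.EqvGen.refl _, fun h => Relation.EqvGen.symm _ _ h,
      fun h h' => Relation.EqvGen.trans _ _ _ h h'⟩⟩ with hS
  have hcard : 2 ^ numLoops a b = Nat.card (Quotient S → Bool) := by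
    rw [Nat.card_fun, Nat.card_eq_fintype_card (α := Bool), Fintype.card_bool]
    rfl
  rw [hcard, ← Nat.card_eq_fintype_card]
  refine Nat.card_eq_of_bijective (fun g s => Quotient.lift
    (fun x : ClosedMid a b => Sum.elim f (Sum.elim g.1 h) x.1) (fun x y hxy =>
      (eqvGen_iff_forall_bool _ _ _).1 hxy _ g.2) s) ⟨?_, ?_⟩
  · rintro ⟨g, hg⟩ ⟨g', hg'⟩ H
    refine Subtype.ext (funext fun j => ?_)
    rcases mid_closed_or_conn a b j with hj | ⟨y, hy⟩
    · exact congrFun H ⟦⟨_, hj⟩⟧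
    · have h1 := (eqvGen_iff_forall_bool _ _ _).1 hy _ hg
      have h2 := (eqvGen_iff_forall_bool _ _ _).1 hy _ hg'
      rw [elim_map] at h1 h2
      exact h1.trans h2.symm
  · intro s
    have outer : ∀ x : Pt l m n, x ∉ ClosedMid a b →
        ∃ y : Fin l ⊕ Fin n, Conn a b x (Sum.map id Sum.inr y) := by
      rintro (i | j | k) hx
      · exact ⟨Sum.inl i, .refl _⟩
      · exact (mid_closed_or_conn a b j).resolve_left hx
      · exact ⟨Sum.inr k, .refl _⟩
    choose o ho using outer
    have uniq : ∀ x y : Fin l ⊕ Fin n, Conn a b (Sum.map id Sum.inr x) (Sum.map id Sum.inr y) →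
        Sum.elim f h x = Sum.elim f h y := by
      intro x y hxy
      by_cases hyx : y = x
      · rw [hyx]
      · rw [← hfh x, hxy.eq_of_outer (hc x) hyx (c.fixedPointFree x)]
    let F : Pt l m n → Bool := fun x =>
      if hx : x ∈ ClosedMid a b then s ⟦⟨x, hx⟩⟧ else Sum.elim f h (o x hx)
    have hF : ∀ x y, Conn a b x y → F x = F y := by
      intro x y hxy
      by_cases hx : x ∈ ClosedMid a b
      · have hy := ClosedMid.of_conn hx hxy
        simp only [F, dif_pos hx, dif_pos hy]
        exact congrArg s (Quotient.sound hxy)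
      · have hy : y ∉ ClosedMid a b := fun hy => hx (ClosedMid.of_conn hy (hxy.symm _ _))
        simp only [F, dif_neg hx, dif_neg hy]
        exact uniq _ _ (((ho x hx).symm _ _).trans _ _ _ (hxy.trans _ _ _ (ho y hy)))
    have hFo : ∀ w : Fin l ⊕ Fin n, F (Sum.map id Sum.inr w) = Sum.elim f h w := by
      intro w
      have hw := outer_notMem_closedMid a b w
      simp only [F, dif_neg hw]
      exact (uniq _ _ (ho _ hw)).symm
    have hFe : Sum.elim f (Sum.elim (fun j => F (Sum.inr (Sum.inl j))) h) = F := by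
      funext x
      rcases x with i | j | k
      · exact (hFo (Sum.inl i)).symm
      · rfl
      · exact (hFo (Sum.inr k)).symm
    refine ⟨⟨fun j => F (Sum.inr (Sum.inl j)), ?_⟩, ?_⟩
    · rw [hFe]
      exact fun u v huv => hF _ _ (.rel _ _ huv)
    · funext q
      induction q using Quotient.inductionOn with
      | h x =>
        simp only [Quotient.lift_mk, hFe]
        simp only [F, dif_pos x.2]

theorem isStack_of_colMat_mul {a : Diagram l m} {b : Diagram m n} {c : Diagram l n} {t e : ℕ}
    (h : 2 ^ t • (colMat a * colMat b) = 2 ^ e • colMat c) : IsStack a b c := by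
  intro x
  rw [Conn, eqvGen_iff_forall_bool]
  intro F hF
  have elimF : Sum.elim (fun i => F (Sum.inl i)) (Sum.elim (fun j => F (Sum.inr (Sum.inl j)))
      (fun k => F (Sum.inr (Sum.inr k)))) = F := by
    funext x; rcases x with i | j | k <;> rfl
  have h1 := congrFun (congrFun h (fun i => F (Sum.inl i))) (fun k => F (Sum.inr (Sum.inr k)))
  have h2 : (colMat a * colMat b) (fun i => F (Sum.inl i)) (fun k => F (Sum.inr (Sum.inr k))) ≠ 0 := by
    rw [Matrix.mul_apply]
    refine (Finset.sum_pos' (fun _ _ => Nat.zero_le _)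
      ⟨fun j => F (Sum.inr (Sum.inl j)), Finset.mem_univ _, ?_⟩).ne'
    rw [colMat_mul_colMat, elimF, if_pos hF]
    exact one_pos
  by_contra hne
  have h3 : colMat c (fun i => F (Sum.inl i)) (fun k => F (Sum.inr (Sum.inr k))) = 0 := by
    rw [colMat, if_neg]
    intro H
    have := H x
    have e1 : ∀ w : Fin l ⊕ Fin n, Sum.elim (fun i => F (Sum.inl i)) (fun k => F (Sum.inr (Sum.inr k))) w
      = F (Sum.map id Sum.inr w) := by rintro (i | j) <;> rfl
    rw [e1, e1] at this
    exact hne this.symm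
  simp only [Matrix.smul_apply, smul_eq_mul, h3, mul_zero] at h1
  simp [h2] at h1

theorem eq_of_smul_colMat_eq {c c' : Diagram m n} {e e' : ℕ}
    (h : 2 ^ e • colMat c = 2 ^ e' • colMat c') : e = e' ∧ c = c' := by
  have he : e = e' := by
    have := congrFun (congrFun h (fun _ => true)) (fun _ => true)
    simp only [Matrix.smul_apply, colMat_apply_const, smul_eq_mul, mul_one] at this
    exact Nat.pow_right_injective le_rfl this
  subst he
  refine ⟨rfl, Diagram.ext_pair (funext fun x => ?_)⟩
  by_contra hne
  have hx := c.fixedPointFree x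
  let F : Fin m ⊕ Fin n → Bool := fun y => decide (y = x ∨ y = c.pair x)
  have hF : Sum.elim (fun i => F (Sum.inl i)) (fun j => F (Sum.inr j)) = F := Sum.elim_comp_inl_inr F
  have h1 := congrFun (congrFun h (fun i => F (Sum.inl i))) (fun j => F (Sum.inr j))
  simp only [Matrix.smul_apply, smul_eq_mul, colMat, hF] at h1
  rw [if_pos, if_neg] at h1
  · simp at h1
  · intro H
    have := H x
    simp [F] at this
    rcases this with h | h
    · exact c'.fixedPointFree x h
    · exact hne h.symm
  · intro y
    simp only [F, decide_eq_decide]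
    rw [c.involutive.injective.eq_iff, or_comm, c.involutive.eq_iff]

theorem compD_apply_of_colMat_mul (d : K) {a : Diagram l m} {b : Diagram m n} {c : Diagram l n}
    {t e : ℕ} (h : 2 ^ t • (colMat a * colMat b) = 2 ^ e • colMat c) :
    d ^ t * compD d b a c = d ^ e := by
  have hs := isStack_of_colMat_mul h
  rw [hs.colMat_mul, smul_smul, ← pow_add] at h
  rw [compD_apply, if_pos hs, ← pow_add, (eq_of_smul_colMat_eq h).1]

theorem compD_eq_of_colMat_mul (d : K) {a : Diagram l m} {b : Diagram m n} {c : Diagram l n}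
    {e : ℕ} (h : colMat a * colMat b = 2 ^ e • colMat c) : compD d b a = d ^ e • single c := by
  funext c'
  by_cases hc : c' = c
  · subst hc
    simpa [single] using compD_apply_of_colMat_mul d (t := 0) (by simpa using h)
  · have : ¬ IsStack a b c' := fun H => hc (eq_of_smul_colMat_eq (H.colMat_mul.symm.trans h)).2
    rw [compD_apply, if_neg this]
    simp [single, hc]

theorem compD_assoc (d : K) {k : ℕ} {a : Diagram k l} {b : Diagram l m} {c : Diagram m n}
    {ab : Diagram k m} {bc : Diagram l n} {s t : ℕ}
    (hab : colMat a * colMat b = 2 ^ s • colMat ab) (hbc : colMat b * colMat c = 2 ^ t • colMat bc) :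
    d ^ s • compD d c ab = d ^ t • compD d bc a := by
  have key : 2 ^ s • (colMat ab * colMat c) = 2 ^ t • (colMat a * colMat bc) := by
    rw [← Matrix.smul_mul, ← hab, ← Matrix.mul_smul, ← hbc, Matrix.mul_assoc]
  funext e
  simp only [Pi.smul_apply, smul_eq_mul]
  by_cases h : IsStack ab c e
  · have h1 := h.colMat_mul
    have h2 : 2 ^ t • (colMat a * colMat bc) = 2 ^ (s + numLoops ab c) • colMat e := by
      rw [← key, h1, smul_smul, ← pow_add]
    rw [compD_apply_of_colMat_mul d h2, compD_apply, if_pos h, pow_add]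
  · have h' : ¬ IsStack a bc e := fun h' => h (isStack_of_colMat_mul (t := s)
      (e := t + numLoops a bc) (by rw [key, h'.colMat_mul, smul_smul, ← pow_add]))
    rw [compD_apply, if_neg h, compD_apply, if_neg h', mul_zero, mul_zero]

end Stack

/-! ### The trace as a count of colourings -/

theorem trace_colMat {n : ℕ} (a : Diagram n n) : (colMat a).trace = 2 ^ trLoops a := by
  have hcard : 2 ^ trLoops a = Nat.card (Quotient (Relation.EqvGen.setoid (closeStep a)) → Bool) := by
    rw [Nat.card_fun, Nat.card_eq_fintype_card (α := Bool), Fintype.card_bool]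
    rfl
  simp only [Matrix.trace, Matrix.diag, colMat]
  rw [Finset.sum_boole, Nat.cast_id, ← Fintype.card_subtype, hcard, ← Nat.card_eq_fintype_card]
  refine Nat.card_congr ⟨fun f => Quotient.lift (Sum.elim f.1 f.1) ?_,
    fun s => ⟨fun i => s (Quotient.mk _ (Sum.inl i)), ?_⟩, ?_, ?_⟩
  · intro x y hxy
    refine (eqvGen_iff_forall_bool _ _ _).1 hxy _ ?_
    rintro u v (rfl | rfl)
    · exact (f.2 u).symm
    · rcases u with u | u <;> rfl
  · have : ∀ x, Sum.elim (fun i => s (Quotient.mk _ (Sum.inl i))) (fun i => s (Quotient.mk _ (Sum.inl i))) x =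
        s (Quotient.mk _ x) := by
      rintro (i | i)
      · rfl
      · exact congrArg s (Quotient.sound (.rel _ _ (Or.inr rfl)))
    intro x
    rw [this, this]
    exact congrArg s (Quotient.sound (.symm _ _ (.rel _ _ (Or.inl rfl))))
  · rintro ⟨f, hf⟩
    rfl
  · intro s
    funext q
    induction q using Quotient.inductionOn with
    | h x =>
      rcases x with i | i
      · rfl
      · exact congrArg s (Quotient.sound (.rel _ _ (Or.inr rfl)))

/-! ### Joining two neighbouring points -/

theorem bIdx_injective (m n : ℕ) : Function.Injective (bIdx m n) := by
  rintro (i | i) (j | j) h <;> simp only [bIdx] at h <;> have := i.isLt <;> have := j.isLt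
  · exact congrArg _ (Fin.ext h)
  · omega
  · omega
  · exact congrArg _ (Fin.ext (by omega))

theorem exists_bIdx_eq {m n k : ℕ} (hk : k < m + n) : ∃ x, bIdx m n x = k := by
  by_cases h : k < m
  · exact ⟨Sum.inl ⟨k, h⟩, rfl⟩
  · exact ⟨Sum.inr ⟨n - 1 - (k - m), by omega⟩, by simp only [bIdx]; omega⟩

theorem bIdx_lt {m n : ℕ} (x : Fin m ⊕ Fin n) : bIdx m n x < m + n := by
  rcases x with i | i <;> simp only [bIdx] <;> have := i.isLt <;> omega

section JoinPair

variable {X : Type*}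

/-- The matching obtained from `π` by joining the partners of `u` and `v`, and pairing `u` with
`v`. -/
noncomputable def joinPair (π : X → X) (u v x : X) : X :=
  if x = u then v else if x = v then u else if π x = u then π v else if π x = v then π u else π x

theorem joinPair_cases (π : X → X) (u v x : X) :
    x = u ∧ joinPair π u v x = v ∨ x ≠ u ∧ x = v ∧ joinPair π u v x = u ∨
    x ≠ u ∧ x ≠ v ∧ π x = u ∧ joinPair π u v x = π v ∨
    x ≠ u ∧ x ≠ v ∧ π x ≠ u ∧ π x = v ∧ joinPair π u v x = π u ∨
    x ≠ u ∧ x ≠ v ∧ π x ≠ u ∧ π x ≠ v ∧ joinPair π u v x = π x := by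
  by_cases h1 : x = u
  · exact Or.inl ⟨h1, if_pos h1⟩
  by_cases h2 : x = v
  · exact Or.inr (Or.inl ⟨h1, h2, by rw [joinPair, if_neg h1, if_pos h2]⟩)
  by_cases h3 : π x = u
  · exact Or.inr (Or.inr (Or.inl ⟨h1, h2, h3, by rw [joinPair, if_neg h1, if_neg h2, if_pos h3]⟩))
  by_cases h4 : π x = v
  · exact Or.inr (Or.inr (Or.inr (Or.inl ⟨h1, h2, h3, h4, by
      rw [joinPair, if_neg h1, if_neg h2, if_neg h3, if_pos h4]⟩)))
  · exact Or.inr (Or.inr (Or.inr (Or.inr ⟨h1, h2, h3, h4, by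
      rw [joinPair, if_neg h1, if_neg h2, if_neg h3, if_neg h4]⟩)))

theorem joinPair_of_eq {π : X → X} (hπ : π.Involutive) {u v : X} (h : π u = v) :
    joinPair π u v = π := by
  funext x
  have h1 := hπ x
  have h2 := hπ u
  have h3 := joinPair_cases π u v x
  clear hπ
  grind

theorem joinPair_involutive {π : X → X} (hπ : π.Involutive) (hf : ∀ x, π x ≠ x) {u v : X} :
    (joinPair π u v).Involutive := by
  intro x
  have h1 := hπ x
  have h2 := hπ u
  have h3 := hπ v
  have h4 := joinPair_cases π u v x
  have h5 := joinPair_cases π u v (joinPair π u v x)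
  have h6 := hf u
  have h7 := hf v
  clear hπ hf
  generalize joinPair π u v (joinPair π u v x) = z at *
  generalize joinPair π u v x = y at *
  grind

theorem joinPair_ne {π : X → X} (hπ : π.Involutive) (hf : ∀ x, π x ≠ x) {u v : X} (huv : u ≠ v)
    (x : X) : joinPair π u v x ≠ x := by
  have h1 := hπ x
  have h2 := hπ u
  have h3 := hπ v
  have h4 := hf x
  have h5 := joinPair_cases π u v x
  clear hπ hf
  grind

/-- The colouring `F` recoloured by `t` at `u` and `v`. -/
noncomputable def recolor (F : X → Bool) (u v : X) (t : Bool) : X → Bool :=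
  fun x => if x = u ∨ x = v then t else F x

theorem recolor_cases (F : X → Bool) (u v : X) (t : Bool) (x : X) :
    x = u ∧ recolor F u v t x = t ∨ x ≠ u ∧ x = v ∧ recolor F u v t x = t ∨
    x ≠ u ∧ x ≠ v ∧ recolor F u v t x = F x := by
  by_cases h1 : x = u
  · exact Or.inl ⟨h1, if_pos (Or.inl h1)⟩
  by_cases h2 : x = v
  · exact Or.inr (Or.inl ⟨h1, h2, if_pos (Or.inr h2)⟩)
  · exact Or.inr (Or.inr ⟨h1, h2, if_neg (by tauto)⟩)

theorem recolor_compat_iff_of_eq {π : X → X} (hπ : π.Involutive) {u v : X} (h : π u = v)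
    {F : X → Bool} (hF : F u = F v) (t : Bool) :
    (∀ x, recolor F u v t (π x) = recolor F u v t x) ↔ ∀ x, F (π x) = F x := by
  refine forall_congr' fun x => ?_
  have h1 := hπ x
  have h2 := hπ u
  have h3 := recolor_cases F u v t x
  have h4 := recolor_cases F u v t (π x)
  clear hπ
  grind

theorem recolor_compat_iff_of_ne {π : X → X} (hπ : π.Involutive) (hf : ∀ x, π x ≠ x) {u v : X}
    (h : π u ≠ v) (F : X → Bool) (t : Bool) :
    (∀ x, recolor F u v t (π x) = recolor F u v t x) ↔
      F (π u) = t ∧ F (π v) = t ∧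
        ∀ x, x ≠ u → x ≠ v → x ≠ π u → x ≠ π v → F (π x) = F x := by
  have h2 := hπ u
  have h3 := hπ v
  have h4 := hf u
  have h5 := hf v
  have h6 : π v ≠ u := fun e => h (by rw [← e, h3])
  have c := recolor_cases F u v t
  constructor
  · intro H
    refine ⟨?_, ?_, fun x a1 a2 a3 a4 => ?_⟩
    · have := H u; have := c u; have := c (π u); clear H c hπ hf; grind
    · have := H v; have := c v; have := c (π v); clear H c hπ hf; grind
    · have := H x; have := hπ x; have := c x; have := c (π x); clear H c hπ hf; grind
  · rintro ⟨H1, H2, H3⟩ x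
    have := hπ x
    have := c x
    have := c (π x)
    by_cases a1 : x = u
    · clear H3 c hπ hf; grind
    by_cases a2 : x = v
    · clear H3 c hπ hf; grind
    by_cases a3 : x = π u
    · clear H3 c hπ hf; grind
    by_cases a4 : x = π v
    · clear H3 c hπ hf; grind
    have := H3 x a1 a2 a3 a4
    clear H3 c hπ hf
    grind

theorem joinPair_compat_iff_of_ne {π : X → X} (hπ : π.Involutive) (hf : ∀ x, π x ≠ x) {u v : X}
    (h : π u ≠ v) (F : X → Bool) :
    (∀ x, F (joinPair π u v x) = F x) ↔ F u = F v ∧ F (π u) = F (π v) ∧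
        ∀ x, x ≠ u → x ≠ v → x ≠ π u → x ≠ π v → F (π x) = F x := by
  have h2 := hπ u
  have h3 := hπ v
  have h4 := hf u
  have h5 := hf v
  have h6 : π v ≠ u := fun e => h (by rw [← e, h3])
  have c := joinPair_cases π u v
  constructor
  · intro H
    refine ⟨?_, ?_, fun x a1 a2 a3 a4 => ?_⟩
    · have := H u; have := c u; clear H c hπ hf; grind
    · have := H (π u); have := c (π u); clear H c hπ hf; grind
    · have := H x; have := hπ x; have := c x; clear H c hπ hf; grind
  · rintro ⟨H1, H2, H3⟩ x
    have := hπ x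
    have := c x
    by_cases a1 : x = u
    · clear H3 c hπ hf; grind
    by_cases a2 : x = v
    · clear H3 c hπ hf; grind
    by_cases a3 : x = π u
    · clear H3 c hπ hf; grind
    by_cases a4 : x = π v
    · clear H3 c hπ hf; grind
    have := H3 x a1 a2 a3 a4
    clear H3 c hπ hf
    grind

theorem sum_recolor {π : X → X} (hπ : π.Involutive) (hf : ∀ x, π x ≠ x) {u v : X}
    [Decidable (π u = v)] (F : X → Bool) :
    (if F u = F v then ∑ t : Bool, if ∀ x, recolor F u v t (π x) = recolor F u v t x then 1 else 0
      else 0) =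
    2 ^ (if π u = v then 1 else 0) *
      if ∀ x, F (joinPair π u v x) = F x then (1 : ℕ) else 0 := by
  by_cases h : π u = v
  · rw [joinPair_of_eq hπ h, if_pos h]
    by_cases hF : F u = F v
    · simp [recolor_compat_iff_of_eq hπ h hF, hF]
    · have : ¬ ∀ x, F (π x) = F x := fun H => hF (by rw [← h, H])
      simp [this, hF]
  · rw [if_neg h, pow_zero, one_mul]
    simp only [recolor_compat_iff_of_ne hπ hf h, joinPair_compat_iff_of_ne hπ hf h,
      Fintype.sum_bool]
    cases F (π u) <;> cases F (π v) <;> by_cases hF : F u = F v <;> simp [hF]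

end JoinPair

/-- The diagram obtained from `D` by attaching an arc at two neighbouring points `u`, `v`. -/
noncomputable def Diagram.join {m n : ℕ} (D : Diagram m n) (u v : Fin m ⊕ Fin n)
    (huv : bIdx m n u + 1 = bIdx m n v) : Diagram m n where
  pair := joinPair D.pair u v
  involutive := joinPair_involutive D.involutive D.fixedPointFree
  fixedPointFree := joinPair_ne D.involutive D.fixedPointFree (by rintro rfl; omega)
  noncrossing := by
    have inj := bIdx_injective m n
    have hi := D.involutive
    have nc := D.noncrossing
    generalize bIdx m n = idx at *
    generalize D.pair = π at *
    have ne : ∀ {x y}, x ≠ y → idx x ≠ idx y := fun h => inj.ne h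
    have nep : ∀ {x y}, x ≠ y → idx (π x) ≠ idx (π y) := fun h => inj.ne (hi.injective.ne h)
    intro x y
    rcases joinPair_cases π u v x with ⟨rfl, hx⟩ | ⟨-, rfl, hx⟩ | ⟨x1, x2, x3, hx⟩ |
      ⟨x1, x2, -, x3, hx⟩ | ⟨x1, x2, x3, x4, hx⟩
    · rw [hx]; omega
    · rw [hx]; omega
    all_goals
      rcases joinPair_cases π u v y with ⟨rfl, hy⟩ | ⟨-, rfl, hy⟩ | ⟨y1, y2, y3, hy⟩ |
        ⟨y1, y2, -, y3, hy⟩ | ⟨y1, y2, y3, y4, hy⟩ <;> rw [hx, hy]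
      · omega
      · omega
    · rw [hi.injective (x3.trans y3.symm)]; omega
    · rw [← y3, hi]; omega
    · subst x3
      have := nc v y
      have := nc y (π v)
      have := nc x y
      have := hi v
      have := hi y
      have := ne y1
      have := ne y2
      have := ne y3
      have := ne y4
      have := nep y1
      have := nep y2
      grind
    · rw [← y3, hi]; omega
    · rw [hi.injective (x3.trans y3.symm)]; omega
    · subst x3
      have := nc u y
      have := nc y (π u)
      have := nc x y
      have := hi u
      have := hi y
      have := ne y1
      have := ne y2
      have := ne y3
      have := ne y4
      have := nep y1
      have := nep y2
      grind
    · subst y3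
      have := nc x v
      have := nc x y
      have := nc x (π y)
      have := nc (π v) x
      have := hi y
      have := hi v
      have := hi x
      have := ne x1
      have := ne x2
      have := ne x3
      have := ne x4
      have := nep x1
      have := nep x2
      grind
    · subst y3
      have := nc x u
      have := nc x y
      have := nc x (π y)
      have := nc (π u) x
      have := hi y
      have := hi u
      have := hi x
      have := ne x1
      have := ne x2
      have := ne x3
      have := ne x4
      have := nep x1
      have := nep x2
      grind
    · exact nc x y

theorem Diagram.exists_adjacent {m n : ℕ} (D : Diagram m n) (x : Fin m ⊕ Fin n)
    (hx : bIdx m n x < bIdx m n (D.pair x)) :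
    ∃ u, bIdx m n u + 1 = bIdx m n (D.pair u) ∧ bIdx m n x ≤ bIdx m n u ∧
      bIdx m n (D.pair u) ≤ bIdx m n (D.pair x) := by
  induction hk : bIdx m n (D.pair x) - bIdx m n x using Nat.strong_induction_on generalizing x with
  | _ k ih =>
    by_cases h1 : bIdx m n x + 1 = bIdx m n (D.pair x)
    · exact ⟨x, h1, le_rfl, le_rfl⟩
    have hlt := bIdx_lt (D.pair x)
    obtain ⟨y, hy⟩ := exists_bIdx_eq (m := m) (n := n) (k := bIdx m n x + 1) (by omega)
    have inj := bIdx_injective m n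
    have n1 := D.noncrossing x y
    have n2 := D.noncrossing (D.pair y) x
    have i1 := D.involutive y
    have i2 := D.involutive x
    have a1 : bIdx m n (D.pair y) ≠ bIdx m n y := inj.ne (D.fixedPointFree y)
    have a2 : bIdx m n (D.pair y) ≠ bIdx m n x := fun h => by
      have := inj h
      rw [← i1, this] at hy
      omega
    have a3 : bIdx m n (D.pair y) ≠ bIdx m n (D.pair x) := fun h => by
      rw [D.involutive.injective (inj h)] at hy
      omega
    rw [i1] at n2
    obtain ⟨u, hu1, hu2, hu3⟩ := ih _ (by omega) y (by omega) rfl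
    exact ⟨u, hu1, by omega, by omega⟩

theorem strictMono_fin_eq {n : ℕ} {f : Fin n → Fin n} (hf : StrictMono f) (i : Fin n) : f i = i := by
  have h : (hf.orderIsoOfSurjective f (Finite.injective_iff_surjective.1 hf.injective)) =
      OrderIso.refl _ := Subsingleton.elim _ _
  exact congrArg (fun e => e i) h

theorem Diagram.exists_top_cap {n : ℕ} {D : Diagram n n} (hD : D ≠ idD n) :
    ∃ (i : ℕ) (hi : i + 1 < n), D.pair (Sum.inl ⟨i, by omega⟩) = Sum.inl ⟨i + 1, hi⟩ := by
  by_cases h : ∃ i j, D.pair (Sum.inl i) = Sum.inl j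
  · obtain ⟨i, j, hij, hlt⟩ : ∃ i j, D.pair (Sum.inl i) = Sum.inl j ∧ i < j := by
      obtain ⟨i, j, hij⟩ := h
      rcases lt_trichotomy i j with hlt | rfl | hlt
      · exact ⟨i, j, hij, hlt⟩
      · exact (D.fixedPointFree _ hij).elim
      · exact ⟨j, i, by rw [← hij, D.involutive], hlt⟩
    obtain ⟨u, h1, h2, h3⟩ := D.exists_adjacent (Sum.inl i) (by rw [hij]; exact hlt)
    rw [hij] at h3
    have hj := j.isLt
    rcases u with u | u
    · rcases hu : D.pair (Sum.inl u) with w | w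
      · rw [hu] at h1
        simp only [bIdx] at h1
        refine ⟨u, by omega, ?_⟩
        rw [← Fin.ext (a := w) (b := ⟨(u : ℕ) + 1, by omega⟩) h1.symm, ← hu]
      · rw [hu] at h3
        simp only [bIdx] at h3
        omega
    · simp only [bIdx] at h1 h3
      omega
  · refine (hD ?_).elim
    push Not at h
    have : ∀ i, ∃ j, D.pair (Sum.inl i) = Sum.inr j := by
      intro i
      rcases hi : D.pair (Sum.inl i) with j | j
      · exact (h i j hi).elim
      · exact ⟨j, rfl⟩
    choose σ hσ using this
    have hmono : StrictMono σ := by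
      intro i j hij
      have := D.noncrossing (Sum.inl i) (Sum.inl j)
      rw [hσ, hσ] at this
      have hne : σ i ≠ σ j := fun e => hij.ne (Sum.inl_injective (D.involutive.injective
        (by rw [hσ, hσ, e])))
      have hne' : (σ i : ℕ) ≠ σ j := fun e => hne (Fin.ext e)
      simp only [bIdx] at this
      rw [Fin.lt_def] at hij ⊢
      have := i.isLt; have := j.isLt; have := (σ i).isLt; have := (σ j).isLt
      omega
    refine Diagram.ext_pair (funext ?_)
    have h1 : ∀ i, D.pair (Sum.inl i) = Sum.inr i := fun i => by
      rw [hσ, strictMono_fin_eq hmono]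
    rintro (i | i)
    · exact h1 i
    · exact (congrArg D.pair (h1 i)).symm.trans (D.involutive _)

theorem Diagram.exists_bot_cap {n : ℕ} {D : Diagram n n} (hD : D ≠ idD n) :
    ∃ (i : ℕ) (hi : i + 1 < n), D.pair (Sum.inr ⟨i + 1, hi⟩) = Sum.inr ⟨i, by omega⟩ := by
  by_cases h : ∃ i j, D.pair (Sum.inr i) = Sum.inr j
  · obtain ⟨i, j, hij, hlt⟩ : ∃ i j, D.pair (Sum.inr i) = Sum.inr j ∧ j < i := by
      obtain ⟨i, j, hij⟩ := h
      rcases lt_trichotomy j i with hlt | rfl | hlt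
      · exact ⟨i, j, hij, hlt⟩
      · exact (D.fixedPointFree _ hij).elim
      · exact ⟨j, i, by rw [← hij, D.involutive], hlt⟩
    have hi := i.isLt
    rw [Fin.lt_def] at hlt
    obtain ⟨u, h1, h2, h3⟩ := D.exists_adjacent (Sum.inr i) (by
      rw [hij]; simp only [bIdx]; omega)
    rw [hij] at h3
    rcases u with u | u
    · simp only [bIdx] at h2
      have := u.isLt
      omega
    · rcases hu : D.pair (Sum.inr u) with w | w
      · rw [hu] at h1
        simp only [bIdx] at h1
        have := w.isLt
        omega
      · rw [hu] at h1
        simp only [bIdx] at h1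
        have := u.isLt
        have hw := w.isLt
        refine ⟨w, by omega, ?_⟩
        rw [← Fin.ext (a := u) (b := ⟨(w : ℕ) + 1, by omega⟩) (by simp only; omega), hu]
  · refine (hD ?_).elim
    push Not at h
    have : ∀ i, ∃ j, D.pair (Sum.inr i) = Sum.inl j := by
      intro i
      rcases hi : D.pair (Sum.inr i) with j | j
      · exact ⟨j, rfl⟩
      · exact (h i j hi).elim
    choose σ hσ using this
    have hσ' : ∀ i, D.pair (Sum.inl (σ i)) = Sum.inr i := fun i => by rw [← hσ, D.involutive]
    have hmono : StrictMono σ := by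
      intro i j hij
      have := D.noncrossing (Sum.inl (σ j)) (Sum.inl (σ i))
      rw [hσ', hσ'] at this
      have hne : σ i ≠ σ j := fun e => hij.ne (Sum.inr_injective (D.involutive.injective
        (by rw [hσ, hσ, e])))
      have hne' : (σ i : ℕ) ≠ σ j := fun e => hne (Fin.ext e)
      simp only [bIdx] at this
      rw [Fin.lt_def] at hij ⊢
      have := i.isLt; have := j.isLt; have := (σ i).isLt; have := (σ j).isLt
      omega
    refine Diagram.ext_pair (funext ?_)
    have h1 : ∀ i, D.pair (Sum.inr i) = Sum.inl i := fun i => by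
      rw [hσ, strictMono_fin_eq hmono]
    rintro (i | i)
    · exact (congrArg D.pair (h1 i)).symm.trans (D.involutive _)
    · exact h1 i

/-! ### The diagrams `E_i` and their matrices -/

section CapMat

variable {n : ℕ}

/-- The matrix of the diagram with one arc at `p`, `q` on either edge and vertical strands
elsewhere. -/
noncomputable def capMat (p q : Fin n) : Matrix (Fin n → Bool) (Fin n → Bool) ℕ :=
  fun f g => if f p = f q ∧ g p = g q ∧ ∀ k, k ≠ p → k ≠ q → f k = g k then 1 else 0

theorem capMat_transpose (p q : Fin n) : (capMat p q).transpose = capMat p q := by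
  ext f g
  simp only [Matrix.transpose_apply, capMat, @eq_comm _ (f _) (g _)]
  congr 1
  exact propext (by tauto)

theorem capMat_comm (p q : Fin n) : capMat p q = capMat q p := by
  ext f g
  simp only [capMat]
  congr 1
  refine propext ⟨fun ⟨h1, h2, h3⟩ => ⟨h1.symm, h2.symm, fun k a b => h3 k b a⟩,
    fun ⟨h1, h2, h3⟩ => ⟨h1.symm, h2.symm, fun k a b => h3 k b a⟩⟩

theorem capMat_mul_apply {Y : Type*} (p q : Fin n) (M : Matrix (Fin n → Bool) Y ℕ)
    (f : Fin n → Bool) (y : Y) :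
    (capMat p q * M) f y = if f p = f q then ∑ t, M (recolor f p q t) y else 0 := by
  rw [Matrix.mul_apply]
  split_ifs with hf
  · have : ∀ g, capMat p q f g = ∑ t, if recolor f p q t = g then 1 else 0 := by
      intro g
      have : ∀ t, recolor f p q t = g ↔
          t = g p ∧ g p = g q ∧ ∀ k, k ≠ p → k ≠ q → f k = g k := by
        intro t
        constructor
        · rintro rfl
          refine ⟨by simp [recolor], by simp [recolor], fun k h1 h2 => by simp [recolor, h1, h2]⟩
        · rintro ⟨rfl, h2, h3⟩
          funext k
          by_cases hk : k = p
          · simp [recolor, hk]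
          by_cases hk' : k = q
          · simp [recolor, hk', h2]
          · simp [recolor, hk, hk', h3 k hk hk']
      simp only [this, ite_and, Finset.sum_ite_eq', Finset.mem_univ, if_true]
      simp only [capMat, hf, true_and, ite_and]
    simp only [this, Finset.sum_mul, ite_mul, one_mul, zero_mul]
    rw [Finset.sum_comm]
    simp
  · simp [capMat, hf]

theorem mul_capMat_apply {Y : Type*} (p q : Fin n) (M : Matrix Y (Fin n → Bool) ℕ)
    (y : Y) (h : Fin n → Bool) :
    (M * capMat p q) y h = if h p = h q then ∑ t, M y (recolor h p q t) else 0 := by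
  rw [← Matrix.transpose_apply (M * _), Matrix.transpose_mul, capMat_transpose, capMat_mul_apply]
  rfl

theorem capMat_recolor (p q : Fin n) (f h : Fin n → Bool) (t : Bool) :
    capMat p q (recolor f p q t) h = if h p = h q ∧ ∀ k, k ≠ p → k ≠ q → f k = h k then 1 else 0 := by
  simp +contextual [capMat, recolor]

theorem capMat_mul_self (p q : Fin n) : capMat p q * capMat p q = 2 • capMat p q := by
  ext f h
  simp only [capMat_mul_apply, capMat_recolor, Matrix.smul_apply]
  simp only [capMat]
  by_cases hf : f p = f q <;> simp [hf]

theorem capMat_mul_mul {p q r : Fin n} (hpq : p ≠ q) (hpr : p ≠ r) (hqr : q ≠ r) :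
    capMat p q * capMat q r * capMat p q = capMat p q := by
  ext f h
  simp only [Matrix.mul_assoc, capMat_mul_apply]
  have e1 : ∀ t, recolor f p q t q = t := fun t => by simp [recolor]
  have e2 : ∀ t, recolor f p q t r = f r := fun t => by simp [recolor, hpr.symm, hqr.symm]
  simp only [e1, e2, Finset.sum_ite_eq', Finset.mem_univ, if_true]
  by_cases hf : f p = f q
  · have e : ∀ s, capMat p q (recolor (recolor f p q (f r)) q r s) h =
        if s = f r then capMat p q f h else 0 := by
      intro s
      have e3 : recolor (recolor f p q (f r)) q r s p = f r := by simp [recolor, hpq, hpr]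
      have e4 : recolor (recolor f p q (f r)) q r s q = s := by simp [recolor]
      split_ifs with hs
      · subst hs
        have e5 : ∀ k, k ≠ p → k ≠ q → recolor (recolor f p q (f r)) q r (f r) k = f k := by
          intro k h1 h2
          by_cases h3 : k = r <;> simp [recolor, h1, h2, h3]
        simp only [capMat, e3, e4, hf, true_and]
        congr 1
        refine propext (and_congr_right fun _ => forall_congr' fun k => forall_congr' fun h1 =>
          forall_congr' fun h2 => by rw [e5 k h1 h2])
      · exact if_neg fun H => hs (by rw [← e4, ← H.1, e3])
    simp [e, hf, -Finset.sum_boole]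
  · simp [capMat, hf]

theorem capMat_commute {p q r s : Fin n} (hpr : p ≠ r) (hps : p ≠ s) (hqr : q ≠ r) (hqs : q ≠ s) :
    capMat p q * capMat r s = capMat r s * capMat p q := by
  suffices H : ∀ M : Matrix (Fin n → Bool) (Fin n → Bool) ℕ,
      capMat p q * capMat r s * M = capMat r s * capMat p q * M by simpa using H 1
  intro M
  ext f h
  simp only [Matrix.mul_assoc, capMat_mul_apply]
  have e1 : ∀ t, recolor f p q t r = f r := fun t => by simp [recolor, hpr.symm, hqr.symm]
  have e2 : ∀ t, recolor f p q t s = f s := fun t => by simp [recolor, hps.symm, hqs.symm]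
  have e3 : ∀ t, recolor f r s t p = f p := fun t => by simp [recolor, hpr, hps]
  have e4 : ∀ t, recolor f r s t q = f q := fun t => by simp [recolor, hqr, hqs]
  have e5 : ∀ t t', recolor (recolor f p q t) r s t' = recolor (recolor f r s t') p q t := by
    intro t t'
    funext k
    have c1 := recolor_cases (recolor f p q t) r s t' k
    have c2 := recolor_cases f p q t k
    have c3 := recolor_cases (recolor f r s t') p q t k
    have c4 := recolor_cases f r s t' k
    grind
  simp only [e1, e2, e3, e4]
  by_cases h1 : f p = f q <;> by_cases h2 : f r = f s <;> simp only [h1, h2, if_true, if_false, Finset.sum_const_zero]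
  rw [Finset.sum_comm]
  simp only [e5]

theorem colMat_idD : colMat (idD n) = 1 := by
  ext f g
  have : (∀ x, Sum.elim f g ((idD n).pair x) = Sum.elim f g x) ↔ f = g := by
    constructor
    · intro h
      funext i
      exact (h (Sum.inl i)).symm
    · rintro rfl (i | i) <;> rfl
  simp only [colMat, this, Matrix.one_apply]

end CapMat

theorem bIdx_inr_add_one {m n i : ℕ} (hi : i + 1 < n) :
    bIdx m n (Sum.inr ⟨i + 1, hi⟩) + 1 = bIdx m n (Sum.inr ⟨i, by omega⟩) := by
  simp only [bIdx]; omega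

/-- The matrix of the diagram `E_i`. -/
noncomputable def eMat {n i : ℕ} (hi : i + 1 < n) : Matrix (Fin n → Bool) (Fin n → Bool) ℕ :=
  capMat ⟨i, by omega⟩ ⟨i + 1, hi⟩

/-- The diagram obtained from `D` by attaching an arc at the `i`-th and `(i+1)`-st bottom points. -/
noncomputable def Diagram.joinBot {m n i : ℕ} (D : Diagram m n) (hi : i + 1 < n) : Diagram m n :=
  D.join (Sum.inr ⟨i + 1, hi⟩) (Sum.inr ⟨i, by omega⟩) (bIdx_inr_add_one hi)

/-- The diagram obtained from `D` by attaching an arc at the `i`-th and `(i+1)`-st top points. -/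
noncomputable def Diagram.joinTop {m n i : ℕ} (D : Diagram m n) (hi : i + 1 < m) : Diagram m n :=
  D.join (Sum.inl ⟨i, by omega⟩) (Sum.inl ⟨i + 1, hi⟩) rfl

theorem colMat_mul_eMat {m n i : ℕ} (D : Diagram m n) (hi : i + 1 < n) :
    colMat D * eMat hi =
      2 ^ (if D.pair (Sum.inr ⟨i + 1, hi⟩) = Sum.inr ⟨i, by omega⟩ then 1 else 0) •
        colMat (D.joinBot hi) := by
  ext f h
  rw [eMat, capMat_comm, mul_capMat_apply, Matrix.smul_apply, smul_eq_mul]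
  have hs := sum_recolor D.involutive D.fixedPointFree (u := Sum.inr ⟨i + 1, hi⟩)
    (v := Sum.inr ⟨i, by omega⟩) (Sum.elim f h)
  have (t : Bool) : Sum.elim f (recolor h ⟨i + 1, hi⟩ ⟨i, by omega⟩ t) =
      recolor (Sum.elim f h) (Sum.inr ⟨i + 1, hi⟩) (Sum.inr ⟨i, by omega⟩) t := by
    ext (k | k) <;> simp [recolor]
  simp only [colMat, this]
  convert hs <;> rfl

theorem eMat_mul_colMat {m n i : ℕ} (D : Diagram m n) (hi : i + 1 < m) :
    eMat hi * colMat D =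
      2 ^ (if D.pair (Sum.inl ⟨i, by omega⟩) = Sum.inl ⟨i + 1, hi⟩ then 1 else 0) •
        colMat (D.joinTop hi) := by
  ext f h
  rw [eMat, capMat_mul_apply, Matrix.smul_apply, smul_eq_mul]
  have hs := sum_recolor D.involutive D.fixedPointFree (u := Sum.inl ⟨i, by omega⟩)
    (v := Sum.inl ⟨i + 1, hi⟩) (Sum.elim f h)
  have (t : Bool) : Sum.elim (recolor f ⟨i, by omega⟩ ⟨i + 1, hi⟩ t) h =
      recolor (Sum.elim f h) (Sum.inl ⟨i, by omega⟩) (Sum.inl ⟨i + 1, hi⟩) t := by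
    ext (k | k) <;> simp [recolor]
  simp only [colMat, this]
  convert hs <;> rfl

/-- The diagram `E_i`. -/
noncomputable def eD {n i : ℕ} (hi : i + 1 < n) : Diagram n n := (idD n).joinBot hi

theorem colMat_eD {n i : ℕ} (hi : i + 1 < n) : colMat (eD hi) = eMat hi := by
  have := colMat_mul_eMat (idD n) hi
  rwa [colMat_idD, one_mul, if_neg (by simp [idD]), pow_zero, one_smul, eq_comm] at this

theorem eHom_eq_single {n i : ℕ} (hi : i + 1 < n) : EHom K n i = single (eD hi) := by
  have : eiPair n i = (eD hi).pair := by
    funext x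
    have hq : (i + 1) % n = i + 1 := Nat.mod_eq_of_lt hi
    rcases x with ⟨x, hx⟩ | ⟨x, hx⟩ <;>
      by_cases h1 : x = i <;> by_cases h2 : x = i + 1 <;>
        simp [eiPair, eD, Diagram.joinBot, Diagram.join, joinPair, idD, h1, h2, hq]
  funext c
  simp only [EHom, single, this]
  congr 1
  exact propext ⟨fun h => Diagram.ext_pair h, fun h => h ▸ rfl⟩

theorem Diagram.joinBot_ne_idD {n i : ℕ} (D : Diagram n n) (hi : i + 1 < n) :
    D.joinBot hi ≠ idD n := by
  intro h
  have := congrArg (fun D => D.pair (Sum.inr ⟨i + 1, hi⟩)) h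
  simp [Diagram.joinBot, Diagram.join, joinPair, idD] at this

theorem Diagram.joinBot_pair_vertical {n i : ℕ} {D : Diagram n n} (hi : i + 1 < n) {j : Fin n}
    (hij : i + 1 < j) (hD : D.pair (Sum.inl j) = Sum.inr j) :
    (D.joinBot hi).pair (Sum.inl j) = Sum.inr j := by
  have h1 : j ≠ ⟨i, by omega⟩ := fun h => by rw [h] at hij; simp at hij
  have h2 : j ≠ ⟨i + 1, hi⟩ := fun h => by rw [h] at hij; simp at hij
  simp [Diagram.joinBot, Diagram.join, joinPair, hD, h1, h2]

theorem two_mul_trace_mul_eMat {n i : ℕ} {D : Diagram n n} (hi : i + 1 < n)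
    (hD : D.pair (Sum.inl ⟨i + 1, hi⟩) = Sum.inr ⟨i + 1, hi⟩) :
    2 * (colMat D * eMat hi).trace = (colMat D).trace := by
  have hne : (⟨i, by omega⟩ : Fin n) ≠ ⟨i + 1, hi⟩ := by simp
  rw [eMat]
  generalize (⟨i + 1, hi⟩ : Fin n) = q at *
  generalize (⟨i, _⟩ : Fin n) = p at *
  have h0 : ∀ f g, f q ≠ g q → colMat D f g = 0 := fun f g hfg =>
    if_neg fun H => hfg (by simpa [hD] using (H (Sum.inl q)).symm)
  have h1 : ∀ f t, colMat D (recolor f q q t) (recolor f q q t) = colMat D f f := by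
    intro f t
    have : Sum.elim (recolor f q q t) (recolor f q q t) =
        recolor (Sum.elim f f) (Sum.inl q) (Sum.inr q) t := by
      ext (k | k) <;> simp [recolor]
    simp only [colMat, this]
    congr 1
    exact propext (recolor_compat_iff_of_eq D.involutive hD rfl t)
  have h2 : ∀ f, (colMat D * capMat p q) f f = if f p = f q then colMat D f f else 0 := by
    intro f
    rw [mul_capMat_apply]
    refine if_ctx_congr Iff.rfl (fun hf => ?_) (fun _ => rfl)
    rw [Finset.sum_eq_single (f p)]
    · congr 1
      funext k
      by_cases h3 : k = p
      · simp [recolor, h3]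
      by_cases h4 : k = q <;> simp [recolor, h3, h4, hf]
    · intro t _ ht
      exact h0 _ _ (by simpa [recolor, ← hf] using ht.symm)
    · simp
  have h3 : ∑ f, (if f p = f q then colMat D f f else 0) =
      ∑ f, (if f p = f q then 0 else colMat D f f) := by
    have hinv : ∀ f : Fin n → Bool, recolor (recolor f q q (!f q)) q q
        (!recolor f q q (!f q) q) = f := by
      intro f
      funext k
      by_cases hk : k = q <;> simp [recolor, hk]
    refine Finset.sum_nbij' (fun f => recolor f q q (!f q)) (fun f => recolor f q q (!f q))
      (by simp) (by simp) (fun f _ => hinv f) (fun f _ => hinv f) fun f _ => ?_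
    have e1 : recolor f q q (!f q) p = f p := by simp [recolor, hne]
    have e2 : recolor f q q (!f q) q = !f q := by simp [recolor]
    simp only [h1, e1, e2]
    cases f p <;> cases f q <;> rfl
  simp only [Matrix.trace, Matrix.diag, h2]
  rw [two_mul]
  nth_rewrite 2 [h3]
  rw [← Finset.sum_add_distrib]
  exact Finset.sum_congr rfl fun f _ => by split_ifs <;> simp

/-! ### Linear operators on morphism spaces -/

section Linear

variable {l m n : ℕ} (d : K)

/-- Composition of morphisms as a bilinear map. -/
noncomputable def compL (l m n : ℕ) : Hom K m n →ₗ[K] Hom K l m →ₗ[K] Hom K l n :=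
  LinearMap.mk₂ K (comp d)
    (fun b b' a => by
      funext c; simp only [comp, Pi.add_apply, add_mul, Finset.sum_add_distrib])
    (fun k b a => by
      funext c; simp only [comp, Pi.smul_apply, smul_eq_mul, Finset.mul_sum, mul_assoc])
    (fun b a a' => by
      funext c; simp only [comp, Pi.add_apply, mul_add, add_mul, Finset.sum_add_distrib])
    (fun k b a => by
      funext c
      simp only [comp, Pi.smul_apply, smul_eq_mul, Finset.mul_sum, mul_assoc, mul_left_comm k])

/-- The Markov trace as a linear map. -/
noncomputable def trL (n : ℕ) : Hom K n n →ₗ[K] K where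
  toFun := Tr d
  map_add' x y := by simp only [Tr, Pi.add_apply, add_mul, Finset.sum_add_distrib]
  map_smul' k x := by
    simp only [Tr, Pi.smul_apply, smul_eq_mul, mul_assoc, Finset.mul_sum, RingHom.id_apply]

theorem compL_apply (b : Hom K m n) (a : Hom K l m) : compL d l m n b a = comp d b a := rfl

theorem compL_single (p : Diagram m n) (q : Diagram l m) :
    compL d l m n (single p) (single q) = compD d p q := by
  funext c
  simp [compL_apply, comp, single]

theorem trL_single (D : Diagram n n) : trL d n (single D) = d ^ trLoops D := by
  change ∑ p, single D p * d ^ trLoops p = _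
  simp [single]

theorem sum_smul_single (x : Hom K m n) : ∑ D, x D • single D = x := by
  funext c
  simp [single]

theorem hom_ext {W : Type*} [AddCommGroup W] [Module K W] {F G : Hom K m n →ₗ[K] W}
    (h : ∀ D, F (single D) = G (single D)) : F = G := by
  refine LinearMap.ext fun x => ?_
  rw [← sum_smul_single x]
  simp [h]

/-- `x` is a monomial, whose matrix is `M`. -/
def Rep (x : Hom K m n) (M : Matrix (Fin m → Bool) (Fin n → Bool) ℕ) : Prop :=
  ∃ e D, x = d ^ e • single D ∧ M = 2 ^ e • colMat D

variable {d}

theorem Rep.unique {x y : Hom K m n} {M : Matrix (Fin m → Bool) (Fin n → Bool) ℕ}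
    (hx : Rep d x M) (hy : Rep d y M) : x = y := by
  obtain ⟨e, D, rfl, h⟩ := hx
  obtain ⟨e', D', rfl, h'⟩ := hy
  obtain ⟨rfl, rfl⟩ := eq_of_smul_colMat_eq (h.symm.trans h')
  rfl

theorem rep_single (D : Diagram m n) : Rep d (single D) (colMat D) := ⟨0, D, by simp, by simp⟩

theorem Rep.smul {x : Hom K m n} {M : Matrix (Fin m → Bool) (Fin n → Bool) ℕ} (hx : Rep d x M) :
    Rep d (d • x) (2 • M) := by
  obtain ⟨e, D, rfl, rfl⟩ := hx
  exact ⟨e + 1, D, by rw [smul_smul, pow_succ'], by rw [smul_smul, pow_succ']⟩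

theorem Rep.trL_eq {x : Hom K n n} {M : Matrix (Fin n → Bool) (Fin n → Bool) ℕ} (hx : Rep d x M) :
    ∃ k, trL d n x = d ^ k ∧ M.trace = 2 ^ k := by
  obtain ⟨e, D, rfl, rfl⟩ := hx
  refine ⟨e + trLoops D, ?_, ?_⟩
  · rw [map_smul, trL_single, smul_eq_mul, pow_add]
  · rw [Matrix.trace_smul, trace_colMat, smul_eq_mul, pow_add]

theorem Rep.trL_eq_of_trace_eq {x y : Hom K n n} {M N : Matrix (Fin n → Bool) (Fin n → Bool) ℕ}
    (hx : Rep d x M) (hy : Rep d y N) (h : M.trace = N.trace) : trL d n x = trL d n y := by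
  obtain ⟨k, h1, h2⟩ := hx.trL_eq
  obtain ⟨k', h1', h2'⟩ := hy.trL_eq
  rw [h1, h1', Nat.pow_right_injective le_rfl ((h2.symm.trans h).trans h2')]

variable (d) in
/-- Left composition with `E_i`. -/
noncomputable def opL (m n i : ℕ) : Hom K m n →ₗ[K] Hom K m n := compL d m n n (EHom K n i)

variable (d) in
/-- Right composition with `E_i`. -/
noncomputable def opR (m n i : ℕ) : Hom K m n →ₗ[K] Hom K m n :=
  (compL d m m n).flip (EHom K m i)

theorem opL_single {i : ℕ} (hi : i + 1 < n) (D : Diagram m n) :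
    opL d m n i (single D) =
      d ^ (if D.pair (Sum.inr ⟨i + 1, hi⟩) = Sum.inr ⟨i, by omega⟩ then 1 else 0) •
        single (D.joinBot hi) := by
  rw [opL, eHom_eq_single hi, compL_single]
  exact compD_eq_of_colMat_mul d (by rw [colMat_eD, colMat_mul_eMat])

theorem opR_single {i : ℕ} (hi : i + 1 < m) (D : Diagram m n) :
    opR d m n i (single D) =
      d ^ (if D.pair (Sum.inl ⟨i, by omega⟩) = Sum.inl ⟨i + 1, hi⟩ then 1 else 0) •
        single (D.joinTop hi) := by
  rw [opR, LinearMap.flip_apply, eHom_eq_single hi, compL_single]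
  exact compD_eq_of_colMat_mul d (by rw [colMat_eD, eMat_mul_colMat])

theorem Rep.opL {x : Hom K m n} {M : Matrix (Fin m → Bool) (Fin n → Bool) ℕ} (hx : Rep d x M)
    {i : ℕ} (hi : i + 1 < n) : Rep d (opL d m n i x) (M * eMat hi) := by
  obtain ⟨e, D, rfl, rfl⟩ := hx
  rw [map_smul, opL_single hi, Matrix.smul_mul, colMat_mul_eMat, smul_smul, smul_smul, ← pow_add,
    ← pow_add]
  exact ⟨_, _, rfl, rfl⟩

theorem Rep.opR {x : Hom K m n} {M : Matrix (Fin m → Bool) (Fin n → Bool) ℕ} (hx : Rep d x M)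
    {i : ℕ} (hi : i + 1 < m) : Rep d (opR d m n i x) (eMat hi * M) := by
  obtain ⟨e, D, rfl, rfl⟩ := hx
  rw [map_smul, opR_single hi, Matrix.mul_smul, eMat_mul_colMat, smul_smul, smul_smul, ← pow_add,
    ← pow_add]
  exact ⟨_, _, rfl, rfl⟩

theorem opL_opL {i : ℕ} (hi : i + 1 < n) (x : Hom K m n) :
    opL d m n i (opL d m n i x) = d • opL d m n i x := by
  suffices h : opL d m n i ∘ₗ opL d m n i = d • opL d m n i from LinearMap.congr_fun h x
  refine hom_ext fun D => ?_
  refine (((rep_single D).opL hi).opL hi).unique ?_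
  rw [Matrix.mul_assoc, eMat, capMat_mul_self, Matrix.mul_smul]
  exact ((rep_single D).opL hi).smul

theorem eMat_succ_mul_eMat_mul {i : ℕ} (hi : i + 1 < n) (hi' : i + 1 + 1 < n) :
    eMat hi' * eMat hi * eMat hi' = eMat hi' := by
  rw [eMat, eMat, capMat_comm ⟨i, _⟩, capMat_comm ⟨i + 1, _⟩]
  exact capMat_mul_mul (by simp) (by simp; omega) (by simp)

theorem opL_succ_opL_opL_succ {i : ℕ} (hi : i + 1 + 1 < n) (x : Hom K m n) :
    opL d m n (i + 1) (opL d m n i (opL d m n (i + 1) x)) = opL d m n (i + 1) x := by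
  suffices h : opL d m n (i + 1) ∘ₗ opL d m n i ∘ₗ opL d m n (i + 1) = opL d m n (i + 1) from
    LinearMap.congr_fun h x
  refine hom_ext fun D => ?_
  have hi' : i + 1 < n := by omega
  have h1 := (((rep_single (d := d) D).opL hi).opL hi').opL hi
  have h2 := (rep_single (d := d) D).opL hi
  rw [Matrix.mul_assoc, Matrix.mul_assoc, ← Matrix.mul_assoc (eMat _),
    eMat_succ_mul_eMat_mul hi' hi] at h1
  exact h1.unique h2

theorem opL_comm {i j : ℕ} (hij : i + 1 < j) (hj : j + 1 < n) (x : Hom K m n) :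
    opL d m n i (opL d m n j x) = opL d m n j (opL d m n i x) := by
  suffices h : opL d m n i ∘ₗ opL d m n j = opL d m n j ∘ₗ opL d m n i from
    LinearMap.congr_fun h x
  refine hom_ext fun D => ?_
  have hi : i + 1 < n := by omega
  refine (((rep_single D).opL hj).opL hi).unique ?_
  rw [Matrix.mul_assoc, eMat, eMat, capMat_commute, ← Matrix.mul_assoc]
  · exact ((rep_single D).opL hi).opL hj
  all_goals simp only [ne_eq, Fin.mk.injEq]; omega

theorem opL_opR {i j : ℕ} (hi : i + 1 < n) (hj : j + 1 < m) (x : Hom K m n) :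
    opL d m n i (opR d m n j x) = opR d m n j (opL d m n i x) := by
  suffices h : opL d m n i ∘ₗ opR d m n j = opR d m n j ∘ₗ opL d m n i from
    LinearMap.congr_fun h x
  refine hom_ext fun D => ?_
  refine (((rep_single D).opR hj).opL hi).unique ?_
  rw [Matrix.mul_assoc]
  exact ((rep_single D).opL hi).opR hj

theorem opL_one {i : ℕ} (hi : i + 1 < n) :
    opL d n n i (single (idD n)) = opR d n n i (single (idD n)) := by
  refine ((rep_single _).opL hi).unique ?_
  rw [colMat_idD, one_mul, ← mul_one (eMat hi), ← colMat_idD]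
  exact (rep_single _).opR hi

theorem trL_opL {i : ℕ} (hi : i + 1 < n) (x : Hom K n n) :
    trL d n (opL d n n i x) = trL d n (opR d n n i x) := by
  refine LinearMap.congr_fun (f := trL d n ∘ₗ opL d n n i) (g := trL d n ∘ₗ opR d n n i)
    (hom_ext fun D => ?_) x
  exact ((rep_single D).opL hi).trL_eq_of_trace_eq ((rep_single D).opR hi)
    (Matrix.trace_mul_comm _ _)

theorem opL_apply_idD {i : ℕ} (hi : i + 1 < n) (x : Hom K n n) :
    opL d n n i x (idD n) = 0 := by
  refine LinearMap.congr_fun (f := LinearMap.proj (idD n) ∘ₗ opL d n n i) (g := 0)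
    (hom_ext fun D => ?_) x
  rw [LinearMap.comp_apply, opL_single hi]
  rw [map_smul, LinearMap.proj_apply, single, if_neg (D.joinBot_ne_idD hi).symm, smul_zero,
    LinearMap.zero_apply]

variable (K) in
/-- The morphisms whose `j`-th strand is vertical. -/
def vertical (n : ℕ) (j : Fin n) : Submodule K (Hom K n n) :=
  Submodule.span K {x | ∃ D : Diagram n n, D.pair (Sum.inl j) = Sum.inr j ∧ x = single D}

theorem single_idD_mem_vertical (j : Fin n) : single (idD n) ∈ vertical K n j :=
  Submodule.subset_span ⟨idD n, rfl, rfl⟩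

theorem opL_mem_vertical {i : ℕ} (hi : i + 1 < n) {j : Fin n} (hij : i + 1 < j) {x : Hom K n n}
    (hx : x ∈ vertical K n j) : opL d n n i x ∈ vertical K n j := by
  induction hx using Submodule.span_induction with
  | mem x h =>
    obtain ⟨D, hD, rfl⟩ := h
    rw [opL_single hi]
    exact Submodule.smul_mem _ _
      (Submodule.subset_span ⟨_, D.joinBot_pair_vertical hi hij hD, rfl⟩)
  | zero => rw [map_zero]; exact Submodule.zero_mem _
  | add x y _ _ hx hy => rw [map_add]; exact Submodule.add_mem _ hx hy
  | smul k x _ hx => rw [map_smul]; exact Submodule.smul_mem _ _ hx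

theorem trL_opL_of_mem_vertical {i : ℕ} (hi : i + 1 < n) {x : Hom K n n}
    (hx : x ∈ vertical K n ⟨i + 1, hi⟩) : d * trL d n (opL d n n i x) = trL d n x := by
  induction hx using Submodule.span_induction with
  | mem x h =>
    obtain ⟨D, hD, rfl⟩ := h
    rw [← smul_eq_mul, ← map_smul]
    refine ((rep_single D).opL hi).smul.trL_eq_of_trace_eq (rep_single D) ?_
    rw [Matrix.trace_smul, smul_eq_mul, two_mul_trace_mul_eMat hi hD]
  | zero => simp
  | add x y _ _ hx hy => rw [map_add, map_add, mul_add, hx, hy, map_add]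
  | smul k x _ hx => rw [map_smul, map_smul, map_smul, ← hx]; simp [mul_left_comm]

theorem trL_one : trL d n (single (idD n)) = d ^ n := by
  obtain ⟨k, h1, h2⟩ := (rep_single (d := d) (idD n)).trL_eq
  rw [h1]
  congr 1
  rw [colMat_idD, Matrix.trace_one, Fintype.card_fun, Fintype.card_bool, Fintype.card_fin] at h2
  exact Nat.pow_right_injective le_rfl h2.symm

theorem comp_opR {i : ℕ} (hi : i + 1 < m) (y : Hom K m n) (x : Hom K l m) :
    comp d (opR d m n i y) x = comp d y (opL d l m i x) := by
  have : (compL d l m n) ∘ₗ opR d m n i =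
      (LinearMap.lcomp K _ (opL d l m i)) ∘ₗ (compL d l m n) :=
    hom_ext fun D => hom_ext fun D' => by
      simp only [LinearMap.comp_apply, LinearMap.lcomp_apply]
      rw [opR_single hi, opL_single hi, map_smul, map_smul, LinearMap.smul_apply, compL_single,
        compL_single]
      exact (compD_assoc d (by rw [colMat_eD, colMat_mul_eMat])
        (by rw [colMat_eD, eMat_mul_colMat])).symm
  exact LinearMap.congr_fun (LinearMap.congr_fun this y) x

theorem comp_single_idD_left (x : Hom K m n) : comp d (single (idD n)) x = x := by
  refine LinearMap.congr_fun (f := compL d m n n (single (idD n))) (g := LinearMap.id)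
    (hom_ext fun D => ?_) x
  rw [compL_single, compD_eq_of_colMat_mul d (e := 0) (c := D) (by simp [colMat_idD])]
  simp

theorem comp_single_idD_right (x : Hom K m n) : comp d x (single (idD m)) = x := by
  refine LinearMap.congr_fun (f := (compL d m m n).flip (single (idD m))) (g := LinearMap.id)
    (hom_ext fun D => ?_) x
  rw [LinearMap.flip_apply, compL_single,
    compD_eq_of_colMat_mul d (e := 0) (c := D) (by simp [colMat_idD])]
  simp

theorem comp_eq_smul_of_opL_eq_zero (hd : 2 ≤ n → d ≠ 0) {x : Hom K m n}
    (hx : ∀ i, i + 1 < n → opL d m n i x = 0) (y : Hom K n n) :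
    comp d y x = y (idD n) • x := by
  have key : ∀ D : Diagram n n, D ≠ idD n → comp d (single D) x = 0 := by
    intro D hD
    obtain ⟨i, hi, h⟩ := D.exists_top_cap hD
    have h1 := comp_opR hi (single D) x (d := d)
    have h2 : D.joinTop hi = D := Diagram.ext_pair (joinPair_of_eq D.involutive h)
    rw [hx i hi, opR_single hi, if_pos h, h2, pow_one, ← compL_apply, ← compL_apply, map_smul,
      map_zero, LinearMap.smul_apply] at h1
    exact (smul_eq_zero.1 h1).resolve_left (hd (by omega))
  conv_lhs => rw [← sum_smul_single y]
  rw [← compL_apply, map_sum, LinearMap.sum_apply, Finset.sum_eq_single (idD n)]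
  · rw [map_smul, LinearMap.smul_apply, compL_apply, comp_single_idD_left]
  · intro D _ hD
    rw [map_smul, LinearMap.smul_apply, compL_apply, key D hD, smul_zero]
  · simp

theorem comp_eq_smul_of_opR_eq_zero (hd : 2 ≤ m → d ≠ 0) {y : Hom K m n}
    (hy : ∀ i, i + 1 < m → opR d m n i y = 0) (x : Hom K m m) :
    comp d y x = x (idD m) • y := by
  have key : ∀ D : Diagram m m, D ≠ idD m → comp d y (single D) = 0 := by
    intro D hD
    obtain ⟨i, hi, h⟩ := D.exists_bot_cap hD
    have h1 := comp_opR hi y (single D) (d := d)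
    have h2 : D.joinBot hi = D := Diagram.ext_pair (joinPair_of_eq D.involutive h)
    rw [hy i hi, opL_single hi, if_pos h, h2, pow_one, ← compL_apply, ← compL_apply, map_smul,
      map_zero, LinearMap.zero_apply] at h1
    exact (smul_eq_zero.1 h1.symm).resolve_left (hd (by omega))
  conv_lhs => rw [← sum_smul_single x]
  rw [← compL_apply, map_sum, Finset.sum_eq_single (idD m)]
  · rw [map_smul, compL_apply, comp_single_idD_right]
  · intro D _ hD
    rw [map_smul, compL_apply, key D hD, smul_zero]
  · simp

end Linear

/-! ### The Jones–Wenzl recursion -/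

section Recursion

variable {A : Type*} [Ring A] [Algebra K A] (c : ℕ → K) (e : ℕ → A)

/-- The sequence `P₀ = 1`, `P_{k+1} = P_k - c_k P_k e_{k-1} P_k`. -/
def jw : ℕ → A
  | 0 => 1
  | k + 1 => jw k - c k • (jw k * e (k - 1) * jw k)

variable {c e}

theorem jw_succ (k : ℕ) : jw c e (k + 1) = jw c e k - c k • (jw c e k * e (k - 1) * jw c e k) :=
  rfl

theorem jw_one (hc : c 0 = 0) : jw c e 1 = 1 := by
  rw [jw_succ, hc, zero_smul, sub_zero]; rfl

theorem commute_jw (hc : c 0 = 0) {z : A} {k : ℕ} (h : ∀ i, i + 1 < k → Commute z (e i)) :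
    Commute z (jw c e k) := by
  induction k with
  | zero => exact Commute.one_right z
  | succ k ih =>
    rcases k with _ | k
    · rw [jw_one hc]; exact Commute.one_right z
    · have h1 := ih fun i hi => h i (by omega)
      rw [jw_succ]
      exact h1.sub_right (((h1.mul_right (h _ (by omega))).mul_right h1).smul_right _)

theorem jw_properties {d : K} {N : ℕ} (hc : c 0 = 0) (hc' : ∀ k < N, c (k + 1) * (d - c k) = 1)
    (h1 : ∀ i < N, e i * e i = d • e i)
    (h2 : ∀ i, i + 1 < N → e (i + 1) * e i * e (i + 1) = e (i + 1))
    (h3 : ∀ i j, i + 1 < j → j < N → e i * e j = e j * e i) {k : ℕ} (hk : k ≤ N) :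
    (jw c e k * jw c e k = jw c e k ∧ jw c e (k + 1) * jw c e (k + 1) = jw c e (k + 1)) ∧
    (jw c e k * jw c e (k + 1) = jw c e (k + 1) ∧ jw c e (k + 1) * jw c e k = jw c e (k + 1)) ∧
    ∀ i < k, e i * jw c e (k + 1) = 0 ∧ jw c e (k + 1) * e i = 0 := by
  induction k with
  | zero => rw [zero_add, jw_one hc]; simp [jw]
  | succ k ih =>
    obtain ⟨⟨QQ, PP⟩, ⟨QP, PQ⟩, eP⟩ := ih (by omega)
    have EQ : e k * jw c e k = jw c e k * e k :=
      commute_jw hc fun i hi => (h3 i k hi (by omega)).symm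
    have EE := h1 k (by omega)
    have EPE : c (k + 1) • (e k * jw c e (k + 1) * e k) = jw c e k * e k := by
      have hEeE : c k • (e k * e (k - 1) * e k) = c k • e k := by
        rcases k with _ | k
        · simp [hc]
        · rw [Nat.add_sub_cancel, h2 k (by omega)]
      have : e k * jw c e (k + 1) * e k = (d - c k) • (jw c e k * e k) := by
        have h4 : e k * (jw c e k * e (k - 1) * jw c e k) * e k =
            jw c e k * (e k * e (k - 1) * e k) * jw c e k := by
          simp only [mul_assoc]
          rw [← EQ, ← mul_assoc (e k) (jw c e k), EQ, mul_assoc]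
        have h5 : e k * jw c e k * e k = d • (jw c e k * e k) := by
          rw [EQ, mul_assoc, EE, mul_smul_comm]
        have h6 : jw c e k * e k * jw c e k = jw c e k * e k := by
          rw [mul_assoc, EQ, ← mul_assoc, QQ]
        rw [jw_succ, mul_sub, sub_mul, mul_smul_comm, smul_mul_assoc, h4, h5, ← smul_mul_assoc (c k),
          ← mul_smul_comm (c k), hEeE, mul_smul_comm, smul_mul_assoc, h6, sub_smul]
      rw [this, smul_smul, hc' k (by omega), one_smul]
    have hR := jw_succ (c := c) (e := e) (k + 1)
    rw [Nat.add_sub_cancel] at hR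
    generalize jw c e (k + 1 + 1) = R at *
    generalize jw c e (k + 1) = P at *
    generalize jw c e k = Q at *
    have PR : P * R = R := by
      rw [hR, mul_sub, PP, mul_smul_comm, ← mul_assoc, ← mul_assoc, PP]
    have RP : R * P = R := by
      rw [hR, sub_mul, PP, smul_mul_assoc, mul_assoc _ P P, PP]
    have ER : e k * R = 0 := by
      rw [hR, mul_sub, mul_smul_comm, ← mul_assoc, ← mul_assoc, ← smul_mul_assoc, EPE, ← EQ,
        mul_assoc, QP, sub_self]
    have RE : R * e k = 0 := by
      rw [hR, sub_mul, smul_mul_assoc, mul_assoc P, mul_assoc P, ← mul_smul_comm, EPE, ← mul_assoc,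
        PQ, sub_self]
    have RR : R * R = R := by
      nth_rewrite 1 [hR]
      rw [sub_mul, PR, smul_mul_assoc, mul_assoc _ P, PR, mul_assoc P, ER, mul_zero, smul_zero,
        sub_zero]
    refine ⟨⟨PP, RR⟩, ⟨PR, RP⟩, fun i hi => ?_⟩
    rcases Nat.lt_succ_iff_lt_or_eq.1 hi with hi | rfl
    · rw [← PR, ← mul_assoc, (eP i hi).1, zero_mul, PR, ← RP, mul_assoc, (eP i hi).2, mul_zero]
      exact ⟨rfl, rfl⟩
    · exact ⟨ER, RE⟩

end Recursion

section Operators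

variable {V : Type*} [AddCommGroup V] [Module K V] {c : ℕ → K} {e f : ℕ → Module.End K V}

theorem jw_succ_apply (k : ℕ) (v : V) : jw c e (k + 1) v =
    jw c e k v - c k • jw c e k (e (k - 1) (jw c e k v)) := rfl

theorem jw_one_apply (hc : c 0 = 0) (v : V) : jw c e 1 v = v := by
  rw [jw_one hc]; rfl

theorem apply_jw_apply (hc : c 0 = 0) {φ : V →ₗ[K] K} {k : ℕ}
    (h : ∀ i, i + 1 < k → ∀ v, φ (e i v) = 0) (v : V) : φ (jw c e k v) = φ v := by
  induction k generalizing v with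
  | zero => rfl
  | succ k ih =>
    rcases k with _ | k
    · rw [jw_one_apply hc]
    · have ih' := ih fun i hi => h i (by omega)
      rw [jw_succ_apply, map_sub, map_smul, ih', ih', h _ (by omega), smul_zero, sub_zero]

theorem jw_apply_mem (hc : c 0 = 0) {W : Submodule K V} {k : ℕ}
    (h : ∀ i, i + 1 < k → ∀ v ∈ W, e i v ∈ W) {v : V} (hv : v ∈ W) : jw c e k v ∈ W := by
  induction k generalizing v with
  | zero => exact hv
  | succ k ih =>
    rcases k with _ | k
    · rwa [jw_one_apply hc]
    · have ih' : ∀ v ∈ W, jw c e (k + 1) v ∈ W := fun v hv => ih (fun i hi => h i (by omega)) hv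
      rw [jw_succ_apply]
      exact W.sub_mem (ih' _ hv) (W.smul_mem _ (ih' _ (h _ (by omega) _ (ih' _ hv))))

theorem jw_jw_comm (hc : c 0 = 0) {k l : ℕ}
    (h : ∀ i j, i + 1 < k → j + 1 < l → Commute (e i) (f j)) : Commute (jw c e k) (jw c f l) :=
  commute_jw hc fun j hj => (commute_jw hc fun i hi => (h i j hi hj).symm).symm

theorem jw_apply_eq_jw_apply (hc : c 0 = 0) {k : ℕ} {v : V}
    (h : ∀ i j, i + 1 < k → j + 1 < k → Commute (e i) (f j)) (hv : ∀ i, i + 1 < k → e i v = f i v) :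
    jw c e k v = jw c f k v := by
  induction k with
  | zero => rfl
  | succ k ih =>
    rcases k with _ | k
    · rw [jw_one_apply hc, jw_one_apply hc]
    · have ih' := ih (fun i j hi hj => h i j (by omega) (by omega)) fun i hi => hv i (by omega)
      have h1 : Commute (jw c e (k + 1)) (jw c f (k + 1)) :=
        jw_jw_comm hc fun i j hi hj => h i j (by omega) (by omega)
      have h2 : Commute (e k) (jw c f (k + 1)) :=
        commute_jw hc fun j hj => h k j (by omega) (by omega)
      have h3 : Commute (f k) (jw c e (k + 1)) :=
        commute_jw hc fun j hj => (h j k (by omega) (by omega)).symm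
      rw [jw_succ_apply (k + 1), jw_succ_apply (k + 1), Nat.add_sub_cancel, ih']
      congr 2
      rw [← Module.End.mul_apply (e k), h2.eq, Module.End.mul_apply, hv k (by omega),
        ← Module.End.mul_apply, h1.eq, Module.End.mul_apply, ← Module.End.mul_apply _ (f k),
        ← h3.eq, Module.End.mul_apply, ih']

theorem apply_jw_eq_apply_jw (hc : c 0 = 0) {k : ℕ} {τ : V →ₗ[K] K}
    (h : ∀ i j, i + 1 < k → j + 1 < k → Commute (e i) (f j))
    (hτ : ∀ i, i + 1 < k → ∀ v, τ (e i v) = τ (f i v)) (v : V) :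
    τ (jw c e k v) = τ (jw c f k v) := by
  induction k generalizing v with
  | zero => rfl
  | succ k ih =>
    rcases k with _ | k
    · rw [jw_one_apply hc, jw_one_apply hc]
    · have ih' := ih (fun i j hi hj => h i j (by omega) (by omega)) fun i hi => hτ i (by omega)
      have h1 : Commute (jw c e (k + 1)) (jw c f (k + 1)) :=
        jw_jw_comm hc fun i j hi hj => h i j (by omega) (by omega)
      have h2 : Commute (e k) (jw c f (k + 1)) :=
        commute_jw hc fun j hj => h k j (by omega) (by omega)
      have h3 : Commute (f k) (jw c e (k + 1)) :=
        commute_jw hc fun j hj => (h j k (by omega) (by omega)).symm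
      rw [jw_succ_apply (k + 1), jw_succ_apply (k + 1), Nat.add_sub_cancel, map_sub, map_sub, map_smul, map_smul,
        ih', ih', ← Module.End.mul_apply _ (e k), ← h2.eq, Module.End.mul_apply, hτ k (by omega),
        ← Module.End.mul_apply (jw c f _) (jw c e _), ← h1.eq, Module.End.mul_apply,
        ← Module.End.mul_apply (f k), h3.eq, Module.End.mul_apply, ih']

end Operators

/-! ### The Jones–Wenzl idempotent -/

section JonesWenzl

variable {n : ℕ} (d : K)

/-- The coefficients `[k] / [k+1]` of the Jones–Wenzl recursion. -/
noncomputable def jwCoeff (k : ℕ) : K := qInt d k / qInt d (k + 1)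

variable (n) in
/-- The image of `1_n` under the `k`-th term of the Jones–Wenzl recursion in left compositions. -/
noncomputable def jwHom (k : ℕ) : Hom K n n :=
  jw (A := Module.End K (Hom K n n)) (jwCoeff d) (opL d n n) k (single (idD n))

variable {d}

theorem jwCoeff_zero : jwCoeff d 0 = 0 := by simp [jwCoeff, qInt]

theorem sub_jwCoeff {k : ℕ} (hk : qInt d (k + 1) ≠ 0) :
    d - jwCoeff d k = qInt d (k + 2) / qInt d (k + 1) := by
  rw [jwCoeff, eq_div_iff hk, sub_mul, div_mul_cancel₀ _ hk]
  rfl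

theorem jwHom_succ (k : ℕ) : jwHom n d (k + 1) = jwHom n d k - jwCoeff d k •
    jw (A := Module.End K (Hom K n n)) (jwCoeff d) (opL d n n) k
      (opL d n n (k - 1) (jwHom n d k)) := rfl

theorem jwHom_one : jwHom n d 1 = single (idD n) := jw_one_apply jwCoeff_zero _

theorem commute_opL_opR {i j : ℕ} (hi : i + 1 < n) (hj : j + 1 < n) :
    Commute (S := Module.End K (Hom K n n)) (opL d n n i) (opR d n n j) :=
  LinearMap.ext fun x => opL_opR hi hj x

theorem jwHom_eq_opR {k : ℕ} (hk : k ≤ n) : jwHom n d k =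
    jw (A := Module.End K (Hom K n n)) (jwCoeff d) (opR d n n) k (single (idD n)) :=
  jw_apply_eq_jw_apply jwCoeff_zero
    (fun _ _ hi hj => commute_opL_opR (by omega) (by omega)) fun _ hi => opL_one (by omega)

theorem jwHom_apply_idD {k : ℕ} (hk : k ≤ n) : jwHom n d k (idD n) = 1 := by
  have := apply_jw_apply (e := opL d n n) (jwCoeff_zero (d := d)) (φ := LinearMap.proj (idD n))
    (k := k) (fun i hi x => opL_apply_idD (by omega) x) (single (idD n))
  refine Eq.trans this ?_
  simp [single]

theorem opL_mul_self {i : ℕ} (hi : i + 1 < n) :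
    (opL d n n i * opL d n n i : Module.End K (Hom K n n)) = d • opL d n n i := by
  refine LinearMap.ext fun x => ?_
  rw [Module.End.mul_apply, LinearMap.smul_apply]
  exact opL_opL hi x

theorem opL_succ_mul_opL_mul_opL_succ {i : ℕ} (hi : i + 1 + 1 < n) :
    (opL d n n (i + 1) * opL d n n i * opL d n n (i + 1) : Module.End K (Hom K n n)) =
      opL d n n (i + 1) := by
  refine LinearMap.ext fun x => ?_
  rw [Module.End.mul_apply, Module.End.mul_apply]
  exact opL_succ_opL_opL_succ hi x

theorem opL_mul_comm {i j : ℕ} (hij : i + 1 < j) (hj : j + 1 < n) :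
    (opL d n n i * opL d n n j : Module.End K (Hom K n n)) = opL d n n j * opL d n n i := by
  refine LinearMap.ext fun x => ?_
  rw [Module.End.mul_apply, Module.End.mul_apply]
  exact opL_comm hij hj x

theorem jw_opL_properties (h : ∀ k, 1 ≤ k → k ≤ n → qInt d k ≠ 0) {k : ℕ} (hk : k < n) :
    (jw (A := Module.End K (Hom K n n)) (jwCoeff d) (opL d n n) k *
      jw (A := Module.End K (Hom K n n)) (jwCoeff d) (opL d n n) k =
        jw (A := Module.End K (Hom K n n)) (jwCoeff d) (opL d n n) k) ∧
    ∀ i < k, (opL d n n i : Module.End K (Hom K n n)) *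
        jw (A := Module.End K (Hom K n n)) (jwCoeff d) (opL d n n) (k + 1) = 0 ∧
      jw (A := Module.End K (Hom K n n)) (jwCoeff d) (opL d n n) (k + 1) *
        (opL d n n i : Module.End K (Hom K n n)) = 0 := by
  have hc : ∀ k < n - 1, jwCoeff d (k + 1) * (d - jwCoeff d k) = 1 := fun k hk => by
    have h1 := h (k + 1) (by omega) (by omega)
    have h2 := h (k + 2) (by omega) (by omega)
    rw [sub_jwCoeff h1, jwCoeff, div_mul_div_cancel₀ h2, div_self h1]
  have h1 := jw_properties (A := Module.End K (Hom K n n)) (e := opL d n n) (N := n - 1) (k := k)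
    jwCoeff_zero hc (fun i hi => opL_mul_self (Nat.add_lt_of_lt_sub hi))
    (fun i hi => opL_succ_mul_opL_mul_opL_succ (Nat.add_lt_of_lt_sub hi))
    (fun i j hij hj => opL_mul_comm hij (Nat.add_lt_of_lt_sub hj)) (Nat.le_sub_one_of_lt hk)
  exact ⟨h1.1.1, h1.2.2⟩

theorem opL_jwHom (h : ∀ k, 1 ≤ k → k ≤ n → qInt d k ≠ 0) {i : ℕ} (hi : i + 1 < n) :
    opL d n n i (jwHom n d n) = 0 := by
  obtain ⟨N, rfl⟩ : ∃ N, n = N + 1 := ⟨n - 1, by omega⟩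
  exact LinearMap.congr_fun ((jw_opL_properties h (Nat.lt_succ_self N)).2 i (by omega)).1 _

theorem opR_jwHom (h : ∀ k, 1 ≤ k → k ≤ n → qInt d k ≠ 0) {i : ℕ} (hi : i + 1 < n) :
    opR d n n i (jwHom n d n) = 0 := by
  have hcomm : Commute (S := Module.End K (Hom K n n)) (opR d n n i)
      (jw (jwCoeff d) (opL d n n) n) :=
    commute_jw jwCoeff_zero fun j hj => (commute_opL_opR (by omega) hi).symm
  obtain ⟨N, rfl⟩ : ∃ N, n = N + 1 := ⟨n - 1, by omega⟩
  refine (LinearMap.congr_fun hcomm.eq (single (idD _))).trans ?_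
  rw [Module.End.mul_apply, ← opL_one hi]
  exact LinearMap.congr_fun ((jw_opL_properties h (Nat.lt_succ_self N)).2 i (by omega)).2 _

/-- The partial trace of the recursion. -/
theorem pow_mul_trL_jwHom (h : ∀ k, 1 ≤ k → k ≤ n → qInt d k ≠ 0) {k : ℕ} (hk : k < n) :
    d ^ (k + 1) * trL d n (jwHom n d (k + 1)) = d ^ n * qInt d (k + 2) := by
  induction k with
  | zero => rw [zero_add, jwHom_one, trL_one, pow_one, mul_comm]; simp [qInt]
  | succ k ih =>
    have hPP := (jw_opL_properties h hk).1
    have hC : Commute (S := Module.End K (Hom K n n)) (opL d n n k)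
        (jw (jwCoeff d) (opR d n n) (k + 1)) :=
      commute_jw jwCoeff_zero fun j hj => commute_opL_opR hk (by omega)
    have hC' : Commute (S := Module.End K (Hom K n n)) (jw (jwCoeff d) (opL d n n) (k + 1))
        (jw (jwCoeff d) (opR d n n) (k + 1)) :=
      jw_jw_comm jwCoeff_zero fun i j hi hj => commute_opL_opR (by omega) (by omega)
    have htr : trL d n (jw (A := Module.End K (Hom K n n)) (jwCoeff d) (opL d n n) (k + 1)
        (opL d n n k (jwHom n d (k + 1)))) = trL d n (opL d n n k (jwHom n d (k + 1))) := by
      rw [apply_jw_eq_apply_jw (f := opR d n n) jwCoeff_zero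
        (fun i j hi hj => commute_opL_opR (by omega) (by omega))
        (fun i hi x => trL_opL (by omega) x)]
      congr 1
      refine (LinearMap.congr_fun hC.eq (jwHom n d (k + 1))).symm.trans ?_
      change opL d n n k _ = _
      congr 1
      refine (LinearMap.congr_fun hC'.eq (single (idD n))).symm.trans ?_
      refine (congrArg (jw (A := Module.End K (Hom K n n)) (jwCoeff d) (opL d n n) (k + 1))
        (jwHom_eq_opR (by omega)).symm).trans ?_
      exact LinearMap.congr_fun hPP (single (idD n))
    have hmar : d * trL d n (opL d n n k (jwHom n d (k + 1))) = trL d n (jwHom n d (k + 1)) :=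
      trL_opL_of_mem_vertical hk (jw_apply_mem jwCoeff_zero
        (fun i hi x hx => opL_mem_vertical (by omega) (by simpa using hi) hx)
        (single_idD_mem_vertical _))
    have hq := h (k + 2) (by omega) (by omega)
    have hs := sub_jwCoeff hq
    rw [eq_div_iff hq] at hs
    rw [jwHom_succ, Nat.add_sub_cancel, map_sub, map_smul, htr, smul_eq_mul]
    have ih' := ih (by omega)
    refine mul_right_cancel₀ hq ?_
    linear_combination (d ^ (k + 1) * trL d n (jwHom n d (k + 1))) * hs
      - d ^ (k + 1) * jwCoeff d (k + 1) * qInt d (k + 2) * hmar + qInt d (k + 3) * ih'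

theorem isJonesWenzl_iff {p : Hom K n n} : IsJonesWenzl d n p ↔ p ≠ 0 ∧ comp d p p = p ∧
    ∀ i, i + 1 < n → opL d n n i p = 0 ∧ opR d n n i p = 0 :=
  Iff.rfl

end JonesWenzl

/-- if `[k] ≠ 0` in `K` for all `1 ≤ k ≤ n` (`n ≥ 1`), then
`T_n` contains a unique Jones–Wenzl idempotent `p_n`, and
`Tr_n(p_n) = [n+1]`. -/
theorem stmt14 (K : Type) [Field K] (d : K) (n : ℕ) (hn : 1 ≤ n)
    (h : ∀ k : ℕ, 1 ≤ k → k ≤ n → qInt d k ≠ 0) :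
    ∃ p : Hom K n n, IsJonesWenzl d n p ∧
      (∀ q : Hom K n n, IsJonesWenzl d n q → q = p) ∧
      Tr d p = qInt d (n + 1) := by
  have hd : 2 ≤ n → d ≠ 0 := fun hn2 => by simpa [qInt] using h 2 (by omega) hn2
  have hL := fun i (hi : i + 1 < n) => opL_jwHom h hi
  have hp1 : jwHom n d n (idD n) = 1 := jwHom_apply_idD le_rfl
  have hleft := comp_eq_smul_of_opL_eq_zero hd hL
  refine ⟨jwHom n d n, isJonesWenzl_iff.2 ⟨fun h0 => ?_, ?_,
    fun i hi => ⟨hL i hi, opR_jwHom h hi⟩⟩, fun q hq => ?_, ?_⟩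
  · simp [h0] at hp1
  · rw [hleft, hp1, one_smul]
  · obtain ⟨hq0, hqq, hqE⟩ := isJonesWenzl_iff.1 hq
    have hright := comp_eq_smul_of_opR_eq_zero hd fun i hi => (hqE i hi).2
    have hq1 : q (idD n) = 1 := by
      have := (hright q).symm.trans hqq
      exact smul_left_injective K hq0 (by simpa using this)
    have := (hright (jwHom n d n)).symm.trans (hleft q)
    rwa [hp1, hq1, one_smul, one_smul] at this
  · change trL d n (jwHom n d n) = _
    obtain ⟨k, rfl⟩ : ∃ k, n = k + 1 := ⟨n - 1, by omega⟩
    rcases k with _ | k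
    · rw [zero_add, jwHom_one, trL_one]
      simp [qInt]
    · exact mul_left_cancel₀ (pow_ne_zero _ (hd (by omega)))
        (pow_mul_trL_jwHom h (Nat.lt_succ_self _))

end TL
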